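/- arXiv:math/9412218 — 3 statements merged into one kernel-verified Lean document; each statement's English description precedes it below -/
import Mathlib

section
/- Main theorem: for 1 < p < ∞, the operator norm of the uncentered Hardy–Littlewood maximal operator M : L^p(ℝ) → L^p(ℝ) equals the unique positive solution c_p of (p-1)x^p − p x^{p-1} − 1 = 0. That is, ‖M f‖_p ≤ c_p ‖f‖_p for all f ∈ L^p(ℝ), and c_p is the smallest constant with this property. -/
open MeasureTheory Set
open scoped ENNReal

/-- The uncentered Hardy-Littlewood maximal function over intervals. -/
noncomputable def M (f : ℝ → ℝ) (x : ℝ) : ℝ≥0∞ :=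
  ⨆ (a : ℝ) (b : ℝ) (_ : a ≤ x) (_ : x ≤ b) (_ : a < b),
    ENNReal.ofReal ((b - a)⁻¹ * ∫ t in a..b, |f t|)


/-- Points where some average to the right exceeds `l`. -/
def setR (f : ℝ → ℝ) (l : ℝ) : Set ℝ := {x | ∃ y, x < y ∧ l * (y - x) < ∫ t in x..y, f t}

/-- Points where some average to the left exceeds `l`. -/
def setL (f : ℝ → ℝ) (l : ℝ) : Set ℝ := {x | ∃ y, y < x ∧ l * (x - y) < ∫ t in y..x, f t}

/-- The auxiliary primitive of `f - l`. -/
noncomputable def primF (f : ℝ → ℝ) (l x : ℝ) : ℝ := (∫ t in (0:ℝ)..x, f t) - l * x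

lemma primF_sub {f : ℝ → ℝ} (hf : Continuous f) (l x y : ℝ) :
    primF f l y - primF f l x = (∫ t in x..y, f t) - l * (y - x) := by
  have := intervalIntegral.integral_interval_sub_left (hf.intervalIntegrable (μ := volume) 0 y)
    (hf.intervalIntegrable 0 x)
  unfold primF
  rw [← this]; ring

lemma primF_hasDerivAt {f : ℝ → ℝ} (hf : Continuous f) (l x : ℝ) :
    HasDerivAt (primF f l) (f x - l) x := by
  have h1 := hf.integral_hasStrictDerivAt 0 x
  have h2 : HasDerivAt (fun x : ℝ => l * x) l x := by
    simpa using (hasDerivAt_id x).const_mul l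
  exact h1.hasDerivAt.sub h2

lemma primF_cont {f : ℝ → ℝ} (hf : Continuous f) (l : ℝ) : Continuous (primF f l) :=
  continuous_iff_continuousAt.2 fun x => (primF_hasDerivAt hf l x).continuousAt

lemma mem_setR {f : ℝ → ℝ} (hf : Continuous f) (l x : ℝ) :
    x ∈ setR f l ↔ ∃ y, x < y ∧ primF f l x < primF f l y := by
  unfold setR
  constructor
  · rintro ⟨y, h1, h2⟩
    exact ⟨y, h1, by linarith [primF_sub hf l x y]⟩
  · rintro ⟨y, h1, h2⟩
    exact ⟨y, h1, by linarith [primF_sub hf l x y]⟩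

lemma isOpen_setR {f : ℝ → ℝ} (hf : Continuous f) (l : ℝ) : IsOpen (setR f l) := by
  have : setR f l = ⋃ y, {x | x < y} ∩ {x | primF f l x < primF f l y} := by
    ext x; rw [mem_setR hf]; simp
  rw [this]
  exact isOpen_iUnion fun y => (isOpen_gt' y).inter
    (isOpen_lt (primF_cont hf l) continuous_const)

lemma gt_mem_setR {f : ℝ → ℝ} (hf : Continuous f) (l x : ℝ) (h : l < f x) : x ∈ setR f l := by
  obtain ⟨e, he, h2⟩ := Metric.isOpen_iff.1 (isOpen_lt continuous_const hf) x h
  refine ⟨x + e / 2, by linarith, ?_⟩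
  have : ∫ t in x..(x + e/2), l < ∫ t in x..(x + e/2), f t := by
    apply intervalIntegral.integral_lt_integral_of_continuousOn_of_le_of_exists_lt (by linarith)
      continuousOn_const hf.continuousOn
    · intro t ht
      have : t ∈ Metric.ball x e := by
        rw [Metric.mem_ball, Real.dist_eq, abs_lt]; constructor <;> linarith [ht.1, ht.2]
      exact le_of_lt (h2 this)
    · exact ⟨x, ⟨le_rfl, by linarith⟩, h⟩
  simp at this ⊢
  linarith

lemma sunR_aux {f : ℝ → ℝ} (hf : Continuous f) (h0 : ∀ x, 0 ≤ f x) {l : ℝ} (hl : 0 < l)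
    {R : ℝ} (hR : 0 < R) (hsupp : ∀ x, R ≤ x → f x = 0) :
    ENNReal.ofReal l * volume (setR f l ∩ Icc (-R) R) ≤
      ∫⁻ x in setR f l, ENNReal.ofReal (f x) := by
  set B := setR f l with hB
  have hBm : MeasurableSet B := (isOpen_setR hf l).measurableSet
  set F := primF f l with hF
  have hFc : Continuous F := primF_cont hf l
  have hsub : Ioc (F R) (F (-R)) ⊆ F '' (Icc (-R) R \ B) := by
    intro v hv
    have hK : IsCompact (Icc (-R) R ∩ {t | v ≤ F t}) :=
      isCompact_Icc.inter_right (isClosed_le continuous_const hFc)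
    obtain ⟨z, hz, hzmax⟩ := hK.exists_isGreatest ⟨-R, ⟨⟨le_rfl, by linarith⟩, hv.2⟩⟩
    have hzR : ∀ w, z < w → w ≤ R → F w < v := by
      intro w hw hwR
      by_contra hcon
      have := hzmax ⟨⟨by linarith [hz.1.1], hwR⟩, not_lt.1 hcon⟩
      linarith
    have hFz : F z = v := by
      apply le_antisymm _ hz.2
      by_contra hcon
      push Not at hcon
      obtain ⟨w, hw, hw2⟩ := intermediate_value_Ioc' hz.1.2 hFc.continuousOn
        (show v ∈ Ico (F R) (F z) from ⟨hv.1.le, hcon⟩)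
      exact (hzR w hw.1 hw.2).ne hw2
    refine ⟨z, ⟨hz.1, ?_⟩, hFz⟩
    rw [hB, mem_setR hf]
    rintro ⟨y, hy, hy2⟩
    rw [← hF, hFz] at hy2
    rcases le_or_gt y R with h | h
    · linarith [hzR y hy h]
    · have h1 := primF_sub hf l R y
      have h2 : ∫ t in R..y, f t = 0 := by
        rw [intervalIntegral.integral_congr (g := fun _ => (0:ℝ))]
        · simp
        · intro t ht
          rw [uIcc_of_le h.le] at ht
          exact hsupp t ht.1
      rw [h2, ← hF] at h1
      nlinarith [hv.1, mul_pos hl (sub_pos.2 h)]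
  have hfl : ∀ x ∈ Icc (-R) R \ B, f x ≤ l := by
    intro x hx
    by_contra h
    exact hx.2 (gt_mem_setR hf l x (not_le.1 h))
  have him := addHaar_image_le_lintegral_abs_det_fderiv volume (s := Icc (-R) R \ B) (f := F)
    (f' := fun x => ContinuousLinearMap.toSpanSingleton ℝ (f x - l))
    (measurableSet_Icc.diff hBm) (fun x _ => (primF_hasDerivAt hf l x).hasFDerivAt.hasFDerivWithinAt)
  have hcfl : Continuous fun x => l - f x := by fun_prop
  have hInt : IntegrableOn (fun x => l - f x) (Icc (-R) R) := hcfl.continuousOn.integrableOn_Icc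
  have h3 : ∫⁻ x in Icc (-R) R \ B, ENNReal.ofReal
      |(ContinuousLinearMap.toSpanSingleton ℝ (f x - l)).det| =
      ENNReal.ofReal (∫ x in Icc (-R) R \ B, (l - f x)) := by
    rw [ofReal_integral_eq_lintegral_ofReal (hInt.mono_set sdiff_subset)]
    · apply setLIntegral_congr_fun (measurableSet_Icc.diff hBm)
      intro x hx
      have := hfl x hx
      simp only [ContinuousLinearMap.det_toSpanSingleton]
      rw [abs_of_nonpos (by linarith)]; ring_nf
    · exact (ae_restrict_iff' (measurableSet_Icc.diff hBm)).2
        (Filter.Eventually.of_forall fun x hx => by simpa using hfl x hx)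
  rw [h3] at him
  have h4 := (measure_mono hsub).trans him
  rw [Real.volume_Ioc, ENNReal.ofReal_le_ofReal_iff
    (setIntegral_nonneg (measurableSet_Icc.diff hBm) fun x hx => by simpa using hfl x hx)] at h4
  have h5 : F (-R) - F R = ∫ x in Icc (-R) R, (l - f x) := by
    rw [integral_Icc_eq_integral_Ioc, ← intervalIntegral.integral_of_le (by linarith),
      intervalIntegral.integral_sub (by simp) (hf.intervalIntegrable _ _)]
    have := primF_sub hf l (-R) R
    simp at this ⊢
    linarith
  have h6 := integral_inter_add_sdiff hBm hInt
  have h7 : ∫ x in Icc (-R) R ∩ B, (l - f x) ≤ 0 := by linarith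
  have hfi : IntegrableOn f (Icc (-R) R ∩ B) :=
    (hf.continuousOn.integrableOn_Icc).mono_set inter_subset_left
  have hci : IntegrableOn (fun _ : ℝ => l) (Icc (-R) R ∩ B) :=
    (continuous_const.continuousOn.integrableOn_Icc).mono_set inter_subset_left
  rw [integral_sub hci hfi] at h7
  have h8 : ENNReal.ofReal (∫ x in Icc (-R) R ∩ B, l) ≤
      ENNReal.ofReal (∫ x in Icc (-R) R ∩ B, f x) := ENNReal.ofReal_le_ofReal (by linarith)
  rw [ofReal_integral_eq_lintegral_ofReal hci (Filter.Eventually.of_forall fun x => hl.le),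
    ofReal_integral_eq_lintegral_ofReal hfi (Filter.Eventually.of_forall fun x => h0 x)] at h8
  rw [setLIntegral_const, inter_comm] at h8
  exact h8.trans (lintegral_mono_set inter_subset_left)

lemma supp_bound {f : ℝ → ℝ} (hs : HasCompactSupport f) :
    ∃ R : ℝ, 0 < R ∧ ∀ x, R ≤ |x| → f x = 0 := by
  obtain ⟨R, hR⟩ := hs.isCompact.isBounded.subset_ball (0:ℝ)
  refine ⟨max R 1, by positivity, fun x hx => ?_⟩
  by_contra h
  have := hR (subset_tsupport f h)
  simp at this
  linarith [le_max_left R 1]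

lemma sunR {f : ℝ → ℝ} (hf : Continuous f) (hs : HasCompactSupport f) (h0 : ∀ x, 0 ≤ f x)
    {l : ℝ} (hl : 0 < l) :
    ENNReal.ofReal l * volume (setR f l) ≤ ∫⁻ x in setR f l, ENNReal.ofReal (f x) := by
  obtain ⟨R, hR, hsupp⟩ := supp_bound hs
  have hmono : Monotone fun n : ℕ => setR f l ∩ Icc (-(R + n)) (R + n) := by
    intro m n hmn
    have : (m : ℝ) ≤ n := by exact_mod_cast hmn
    exact inter_subset_inter_right _ (Icc_subset_Icc (by linarith) (by linarith))
  have ht := tendsto_measure_iUnion_atTop (μ := volume) hmono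
  have hU : ⋃ n : ℕ, setR f l ∩ Icc (-(R + n)) (R + n) = setR f l := by
    rw [← inter_iUnion]
    apply inter_eq_left.2
    intro x _
    obtain ⟨n, hn⟩ := exists_nat_ge |x|
    have := abs_le.1 hn
    exact mem_iUnion.2 ⟨n, by constructor <;> linarith⟩
  rw [hU] at ht
  refine le_of_tendsto' (ENNReal.Tendsto.const_mul ht (Or.inr ENNReal.ofReal_ne_top)) fun n => ?_
  apply sunR_aux hf h0 hl (by positivity)
  intro x hx
  apply hsupp
  rw [abs_of_nonneg] <;> linarith [(Nat.cast_nonneg n : (0:ℝ) ≤ n)]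

lemma setL_eq (f : ℝ → ℝ) (l : ℝ) : setL f l = Neg.neg ⁻¹' setR (fun x => f (-x)) l := by
  ext x
  simp only [setL, setR, mem_ofPred_eq, mem_preimage]
  constructor
  · rintro ⟨y, h, h2⟩
    refine ⟨-y, by linarith, ?_⟩
    rw [intervalIntegral.integral_comp_neg (fun x => f x)]
    simp only [neg_neg]; convert h2 using 1; ring
  · rintro ⟨y, h, h2⟩
    refine ⟨-y, by linarith, ?_⟩
    rw [intervalIntegral.integral_comp_neg (fun x => f x)] at h2
    simp only [neg_neg] at h2; convert h2 using 1; ring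

lemma isOpen_setL {f : ℝ → ℝ} (hf : Continuous f) (l : ℝ) : IsOpen (setL f l) := by
  rw [setL_eq]
  exact (isOpen_setR (hf.comp continuous_neg) l).preimage continuous_neg

lemma gt_mem_setL {f : ℝ → ℝ} (hf : Continuous f) (l x : ℝ) (h : l < f x) : x ∈ setL f l := by
  rw [setL_eq]
  exact gt_mem_setR (hf.comp continuous_neg) l _ (by simpa using h)

lemma sunL {f : ℝ → ℝ} (hf : Continuous f) (hs : HasCompactSupport f) (h0 : ∀ x, 0 ≤ f x)
    {l : ℝ} (hl : 0 < l) :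
    ENNReal.ofReal l * volume (setL f l) ≤ ∫⁻ x in setL f l, ENNReal.ofReal (f x) := by
  have hc : Continuous fun x => f (-x) := hf.comp continuous_neg
  have := sunR (f := fun x => f (-x)) hc
    (hs.comp_homeomorph (Homeomorph.neg ℝ)) (fun x => h0 _) hl
  rw [setL_eq, Measure.measure_preimage_neg]
  refine this.trans (le_of_eq ?_)
  rw [← (Measure.measurePreserving_neg (volume : Measure ℝ)).setLIntegral_comp_preimage
    (isOpen_setR hc l).measurableSet
    (show Measurable fun x => ENNReal.ofReal (f (-x)) from hc.measurable.ennreal_ofReal)]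
  simp

lemma key {f : ℝ → ℝ} (hf : Continuous f) (hs : HasCompactSupport f) (h0 : ∀ x, 0 ≤ f x)
    {l : ℝ} (hl : 0 < l) (ν : Measure ℝ) (hν : ν = volume.withDensity fun x => ENNReal.ofReal (f x)) :
    ENNReal.ofReal l * (volume (setL f l ∪ setR f l) + volume {x | l < f x}) ≤
      ν (setL f l ∪ setR f l) + ν {x | l < f x} := by
  have hA := isOpen_setL hf l
  have hB := isOpen_setR hf l
  set A := setL f l with hAdef
  set B := setR f l with hBdef
  have hC : IsOpen {x | l < f x} := isOpen_lt continuous_const hf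
  set C := {x | l < f x} with hCdef
  have hCA : C ⊆ A ∩ B := fun x hx => ⟨gt_mem_setL hf l x hx, gt_mem_setR hf l x hx⟩
  have hDm : MeasurableSet ((A ∩ B) \ C) :=
    (hA.measurableSet.inter hB.measurableSet).diff hC.measurableSet
  have e1 : ∀ s, MeasurableSet s → ν s = ∫⁻ x in s, ENNReal.ofReal (f x) := fun s hs => by
    rw [hν, withDensity_apply _ hs]
  have hfin : ν ((A ∩ B) \ C) ≠ ∞ := by
    rw [e1 _ hDm]
    have : Integrable f := hf.integrable_of_hasCompactSupport hs
    refine ne_of_lt ((setLIntegral_le_lintegral _ _).trans_lt ?_)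
    rw [← ofReal_integral_eq_lintegral_ofReal this (Filter.Eventually.of_forall h0)]
    exact ENNReal.ofReal_lt_top
  have hD : ν ((A ∩ B) \ C) ≤ ENNReal.ofReal l * volume ((A ∩ B) \ C) := by
    rw [e1 _ hDm, ← setLIntegral_const]
    exact setLIntegral_mono measurable_const fun x hx =>
      ENNReal.ofReal_le_ofReal (not_lt.1 hx.2)
  have s1 := sunL hf hs h0 hl
  have s2 := sunR hf hs h0 hl
  rw [← hAdef, ← e1 _ hA.measurableSet] at s1
  rw [← hBdef, ← e1 _ hB.measurableSet] at s2
  have u1 := measure_union_add_inter (μ := volume) A hB.measurableSet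
  have u2 := measure_union_add_inter (μ := ν) A hB.measurableSet
  have u3 := measure_sdiff_add_inter (μ := volume) (A ∩ B) hC.measurableSet
  have u4 := measure_sdiff_add_inter (μ := ν) (A ∩ B) hC.measurableSet
  rw [inter_eq_right.2 hCA] at u3 u4
  refine ENNReal.le_of_add_le_add_right hfin ?_
  calc _ ≤ ENNReal.ofReal l * (volume (A ∪ B) + volume C) +
        ENNReal.ofReal l * volume ((A ∩ B) \ C) := by gcongr
    _ = ENNReal.ofReal l * (volume (A ∪ B) + (volume ((A ∩ B) \ C) + volume C)) := by ring
    _ = ENNReal.ofReal l * volume A + ENNReal.ofReal l * volume B := by rw [u3, u1]; ring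
    _ ≤ ν A + ν B := add_le_add s1 s2
    _ = ν (A ∪ B) + (ν ((A ∩ B) \ C) + ν C) := by rw [u4, u2]
    _ = _ := by ring

lemma lt_M_iff {f : ℝ → ℝ} (hf : Continuous f) (h0 : ∀ x, 0 ≤ f x) {l : ℝ} (hl : 0 ≤ l) (x : ℝ) :
    ENNReal.ofReal l < M f x ↔ x ∈ setL f l ∪ setR f l := by
  have habs : ∀ t, |f t| = f t := fun t => abs_of_nonneg (h0 t)
  have hdiv : ∀ a b : ℝ, a < b → ∀ S : ℝ, l < (b - a)⁻¹ * S ↔ l * (b - a) < S := by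
    intro a b hab S
    rw [inv_mul_eq_div, lt_div_iff₀ (sub_pos.2 hab)]
  unfold M
  simp only [lt_iSup_iff, habs, ENNReal.ofReal_lt_ofReal_iff_of_nonneg hl]
  constructor
  · rintro ⟨a, b, hax, hxb, hab, h⟩
    rw [hdiv a b hab] at h
    have hadd := intervalIntegral.integral_add_adjacent_intervals
      (hf.intervalIntegrable (μ := volume) a x) (hf.intervalIntegrable x b)
    rcases lt_or_ge (l * (x - a)) (∫ t in a..x, f t) with h1 | h1
    · left
      rcases hax.lt_or_eq with h2 | h2
      · exact ⟨a, h2, h1⟩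
      · subst h2; simp at h1
    · right
      have h3 : l * (b - x) < ∫ t in x..b, f t := by linarith
      rcases hxb.lt_or_eq with h2 | h2
      · exact ⟨b, h2, h3⟩
      · subst h2; simp at h3
  · rintro (⟨y, hy, h⟩ | ⟨y, hy, h⟩)
    · exact ⟨y, x, hy.le, le_rfl, hy, (hdiv _ _ hy _).2 h⟩
    · exact ⟨x, y, le_rfl, hy.le, hy, (hdiv _ _ hy _).2 h⟩

lemma M_measurable {f : ℝ → ℝ} (hf : Continuous f) (h0 : ∀ x, 0 ≤ f x) : Measurable (M f) := by
  refine measurable_of_Ioi fun t => ?_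
  rcases eq_or_ne t ∞ with rfl | ht
  · simp
  · have : M f ⁻¹' Ioi t = setL f t.toReal ∪ setR f t.toReal := by
      ext x
      rw [← lt_M_iff hf h0 ENNReal.toReal_nonneg, ENNReal.ofReal_toReal ht]; rfl
    rw [this]
    exact ((isOpen_setL hf _).union (isOpen_setR hf _)).measurableSet

lemma M_decay {f : ℝ → ℝ} (hf : Continuous f) (hs : HasCompactSupport f) (h0 : ∀ x, 0 ≤ f x) :
    ∃ D : ℝ, 0 ≤ D ∧ ∀ x, M f x ≤ ENNReal.ofReal (D * (1 + |x|)⁻¹) := by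
  obtain ⟨R, hR, hsupp⟩ := supp_bound hs
  obtain ⟨C, hC⟩ := hf.bounded_above_of_compact_support hs
  have hC0 : 0 ≤ C := (norm_nonneg _).trans (hC 0)
  have hfC : ∀ x, f x ≤ C := fun x => (le_abs_self _).trans (hC x)
  have hi : Integrable f := hf.integrable_of_hasCompactSupport hs
  have hS0 : 0 ≤ ∫ t, f t := integral_nonneg h0
  refine ⟨C * (1 + R) + ∫ t, f t, by positivity, fun x => ?_⟩
  unfold M
  refine iSup_le fun a => iSup_le fun b => iSup_le fun hax => iSup_le fun hxb => iSup_le fun hab => ?_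
  apply ENNReal.ofReal_le_ofReal
  simp only [fun t => abs_of_nonneg (h0 t)]
  have hI0 : 0 ≤ ∫ t in a..b, f t := intervalIntegral.integral_nonneg hab.le fun t _ => h0 t
  have hIS : ∫ t in a..b, f t ≤ ∫ t, f t := by
    rw [intervalIntegral.integral_of_le hab.le]
    exact setIntegral_le_integral hi (Filter.Eventually.of_forall h0)
  have hIC : ∫ t in a..b, f t ≤ C * (b - a) := by
    have := intervalIntegral.integral_mono_on hab.le (hf.intervalIntegrable (μ := volume) a b)
      (intervalIntegrable_const (c := C)) (fun t _ => hfC t)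
    simp at this; linarith
  have hL : 0 < b - a := sub_pos.2 hab
  have hx1 : 0 < 1 + |x| := by positivity
  rw [inv_mul_eq_div, ← div_eq_mul_inv, div_le_div_iff₀ hL hx1]
  by_cases hx : |x| ≤ R + (b - a)
  · calc (∫ t in a..b, f t) * (1 + |x|) ≤ (∫ t in a..b, f t) * (1 + R + (b - a)) := by
          exact mul_le_mul_of_nonneg_left (by linarith) hI0
      _ = (∫ t in a..b, f t) * (1 + R) + (∫ t in a..b, f t) * (b - a) := by ring
      _ ≤ C * (b - a) * (1 + R) + (∫ t, f t) * (b - a) := by gcongr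
      _ = _ := by ring
  · have hz : ∫ t in a..b, f t = 0 := by
      rw [intervalIntegral.integral_congr (g := fun _ => (0:ℝ))]
      · simp
      · intro t ht
        rw [uIcc_of_le hab.le] at ht
        apply hsupp
        push Not at hx
        have h1 : |x| ≤ |t| + |x - t| := by
          have := abs_add_le t (x - t); simpa using this
        have h2 : |x - t| ≤ b - a := by
          rw [abs_le]; constructor <;> linarith [ht.1, ht.2]
        linarith
    rw [hz, zero_mul]
    positivity

lemma M_finite {f : ℝ → ℝ} (hf : Continuous f) (hs : HasCompactSupport f) (h0 : ∀ x, 0 ≤ f x)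
    {p : ℝ} (hp : 1 < p) : ∫⁻ x, M f x ^ p < ∞ := by
  obtain ⟨D, hD, h⟩ := M_decay hf hs h0
  have hdecay : Integrable (fun x : ℝ => D ^ p * (1 + ‖x‖) ^ (-p)) :=
    (integrable_one_add_norm (by simpa using hp)).const_mul _
  calc ∫⁻ x, M f x ^ p ≤ ∫⁻ x, ENNReal.ofReal (D ^ p * (1 + ‖x‖) ^ (-p)) := by
        apply lintegral_mono
        intro x
        have hx1 : 0 < 1 + |x| := by positivity
        calc M f x ^ p ≤ ENNReal.ofReal (D * (1 + |x|)⁻¹) ^ p := by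
              gcongr; exact h x
          _ = _ := by
              rw [ENNReal.ofReal_rpow_of_nonneg (by positivity) (by linarith),
                Real.mul_rpow hD (by positivity), Real.inv_rpow hx1.le]
              dsimp only
              rw [Real.norm_eq_abs, Real.rpow_neg hx1.le]
    _ < ∞ := hdecay.lintegral_lt_top

lemma strong_ineq {f : ℝ → ℝ} (hf : Continuous f) (hs : HasCompactSupport f) (h0 : ∀ x, 0 ≤ f x)
    {p : ℝ} (hp : 1 < p) :
    ENNReal.ofReal (p - 1) * ((∫⁻ x, M f x ^ p) + ∫⁻ x, ENNReal.ofReal (f x) ^ p) ≤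
      ENNReal.ofReal p * ((∫⁻ x, ENNReal.ofReal (f x) * M f x ^ (p - 1)) +
        ∫⁻ x, ENNReal.ofReal (f x) ^ p) := by
  have hMt : ∀ x, M f x ≠ ∞ := by
    obtain ⟨D, hD, h⟩ := M_decay hf hs h0
    exact fun x => ne_top_of_le_ne_top ENNReal.ofReal_ne_top (h x)
  have hMm := M_measurable hf h0
  obtain ⟨ν, hν⟩ : ∃ ν : Measure ℝ, ν = volume.withDensity fun x => ENNReal.ofReal (f x) := ⟨_, rfl⟩
  set g : ℝ → ℝ := fun x => (M f x).toReal with hg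
  have hgm : Measurable g := hMm.ennreal_toReal
  have hg0 : ∀ x, 0 ≤ g x := fun x => ENNReal.toReal_nonneg
  have hgM : ∀ x, M f x = ENNReal.ofReal (g x) := fun x => (ENNReal.ofReal_toReal (hMt x)).symm
  have hp0 : 0 < p := by linarith
  have hp1 : 0 < p - 1 := by linarith
  have hX := lintegral_rpow_eq_lintegral_meas_lt_mul volume (Filter.Eventually.of_forall hg0)
    hgm.aemeasurable hp0
  have hY := lintegral_rpow_eq_lintegral_meas_lt_mul volume (Filter.Eventually.of_forall h0)
    hf.measurable.aemeasurable hp0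
  have hZ := lintegral_rpow_eq_lintegral_meas_lt_mul ν (Filter.Eventually.of_forall hg0)
    hgm.aemeasurable hp1
  have hW := lintegral_rpow_eq_lintegral_meas_lt_mul ν (Filter.Eventually.of_forall h0)
    hf.measurable.aemeasurable hp1
  have eX : ∫⁻ x, M f x ^ p = ∫⁻ x, ENNReal.ofReal (g x ^ p) := by
    apply lintegral_congr; intro x
    rw [hgM, ENNReal.ofReal_rpow_of_nonneg (hg0 x) hp0.le]
  have eY : ∫⁻ x, ENNReal.ofReal (f x) ^ p = ∫⁻ x, ENNReal.ofReal (f x ^ p) := by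
    apply lintegral_congr; intro x
    rw [ENNReal.ofReal_rpow_of_nonneg (h0 x) hp0.le]
  have hfm : Measurable fun x => ENNReal.ofReal (f x) := hf.measurable.ennreal_ofReal
  have eZ : ∫⁻ x, ENNReal.ofReal (f x) * M f x ^ (p - 1) =
      ∫⁻ x, ENNReal.ofReal (g x ^ (p - 1)) ∂ν := by
    rw [hν, lintegral_withDensity_eq_lintegral_mul _ hfm (by fun_prop)]
    apply lintegral_congr; intro x
    rw [hgM, ENNReal.ofReal_rpow_of_nonneg (hg0 x) hp1.le]; rfl
  have eW : ∫⁻ x, ENNReal.ofReal (f x) ^ p =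
      ∫⁻ x, ENNReal.ofReal (f x ^ (p - 1)) ∂ν := by
    have := hf.measurable
    rw [hν, lintegral_withDensity_eq_lintegral_mul _ hfm (by fun_prop)]
    apply lintegral_congr; intro x
    simp only [Pi.mul_apply]
    rw [← ENNReal.ofReal_rpow_of_nonneg (h0 x) hp1.le]
    nth_rw 2 [← ENNReal.rpow_one (ENNReal.ofReal (f x))]
    rw [← ENNReal.rpow_add_of_nonneg _ _ zero_le_one hp1.le]; ring_nf
  have hmeas : ∀ (μ : Measure ℝ) (u : ℝ → ℝ) (q : ℝ),
      Measurable fun t : ℝ => μ {a | t < u a} * ENNReal.ofReal (t ^ q) := by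
    intro μ u q
    have h1 : Antitone fun t : ℝ => μ {a | t < u a} := by
      intro s t hst
      exact measure_mono fun a ha => lt_of_le_of_lt hst ha
    exact h1.measurable.mul (by fun_prop)
  have main : (∫⁻ t in Ioi (0:ℝ), volume {a | t < g a} * ENNReal.ofReal (t ^ (p - 1))) +
      (∫⁻ t in Ioi (0:ℝ), volume {a | t < f a} * ENNReal.ofReal (t ^ (p - 1))) ≤
      (∫⁻ t in Ioi (0:ℝ), ν {a | t < g a} * ENNReal.ofReal (t ^ (p - 1 - 1))) +
      (∫⁻ t in Ioi (0:ℝ), ν {a | t < f a} * ENNReal.ofReal (t ^ (p - 1 - 1))) := by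
    rw [← lintegral_add_left (hmeas _ _ _), ← lintegral_add_left (hmeas _ _ _)]
    apply setLIntegral_mono ((hmeas _ _ _).add (hmeas _ _ _))
    intro t ht
    have ht : 0 < t := ht
    have hset : {a | t < g a} = setL f t ∪ setR f t := by
      ext x
      rw [← lt_M_iff hf h0 ht.le, ENNReal.ofReal_lt_iff_lt_toReal ht.le (hMt x)]; rfl
    have hk := key hf hs h0 ht ν hν
    rw [← hset] at hk
    have hpow : ENNReal.ofReal (t ^ (p - 1)) = ENNReal.ofReal t * ENNReal.ofReal (t ^ (p - 1 - 1)) := by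
      rw [← ENNReal.ofReal_mul ht.le, Real.rpow_sub_one ht.ne' (p - 1), mul_div_cancel₀ _ ht.ne']
    rw [hpow]
    calc _ = ENNReal.ofReal t * (volume {a | t < g a} + volume {a | t < f a})
          * ENNReal.ofReal (t ^ (p - 1 - 1)) := by ring
      _ ≤ (ν {a | t < g a} + ν {a | t < f a}) * ENNReal.ofReal (t ^ (p - 1 - 1)) := by gcongr
      _ = _ := by rw [add_mul]; rfl
  calc _ = ENNReal.ofReal (p - 1) * (ENNReal.ofReal p * (
        (∫⁻ t in Ioi (0:ℝ), volume {a | t < g a} * ENNReal.ofReal (t ^ (p - 1))) +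
        (∫⁻ t in Ioi (0:ℝ), volume {a | t < f a} * ENNReal.ofReal (t ^ (p - 1))))) := by
          rw [eX, eY, hX, hY]; ring
    _ ≤ ENNReal.ofReal (p - 1) * (ENNReal.ofReal p * (
      (∫⁻ t in Ioi (0:ℝ), ν {a | t < g a} * ENNReal.ofReal (t ^ (p - 1 - 1))) +
      (∫⁻ t in Ioi (0:ℝ), ν {a | t < f a} * ENNReal.ofReal (t ^ (p - 1 - 1))))) := by gcongr
    _ = _ := by rw [eZ, eW, hZ, hW]; ring

lemma root_le {p cp r : ℝ} (hp : 1 < p) (hcp : 0 < cp)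
    (hroot : (p - 1) * cp ^ p - p * cp ^ (p - 1) - 1 = 0)
    (h : (p - 1) * r ^ p - p * r ^ (p - 1) - 1 ≤ 0) : r ≤ cp := by
  by_contra hlt
  push Not at hlt
  have hr0 : 0 < r := hcp.trans hlt
  have e : ∀ x : ℝ, 0 < x → x ^ p = x ^ (p - 1) * x := fun x hx => by
    rw [Real.rpow_sub_one hx.ne', div_mul_cancel₀ _ hx.ne']
  rw [e cp hcp] at hroot
  rw [e r hr0] at h
  have h1 : cp ^ (p - 1) * ((p - 1) * cp - p) = 1 := by linarith
  have h2 : r ^ (p - 1) * ((p - 1) * r - p) ≤ 1 := by linarith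
  have h3 : 0 < cp ^ (p - 1) := Real.rpow_pos_of_pos hcp _
  have h4 : cp ^ (p - 1) ≤ r ^ (p - 1) := Real.rpow_le_rpow hcp.le hlt.le (by linarith)
  have h5 : 0 < (p - 1) * cp - p := by
    by_contra hc
    nlinarith
  have h6 : (p - 1) * cp < (p - 1) * r := by
    apply mul_lt_mul_of_pos_left hlt; linarith
  nlinarith

lemma bound_cont {p cp : ℝ} (hp : 1 < p) (hcp : 0 < cp)
    (hroot : (p - 1) * cp ^ p - p * cp ^ (p - 1) - 1 = 0)
    {f : ℝ → ℝ} (hf : Continuous f) (hs : HasCompactSupport f) (h0 : ∀ x, 0 ≤ f x) :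
    (∫⁻ x, M f x ^ p) ^ (1 / p)
          ≤ ENNReal.ofReal cp * (∫⁻ x, ENNReal.ofReal (f x) ^ p) ^ (1 / p) := by
  have hp0 : 0 < p := by linarith
  have hp1 : 0 < p - 1 := by linarith
  have hst := strong_ineq hf hs h0 hp
  have hXf := (M_finite hf hs h0 hp).ne
  have hYf : ∫⁻ x, ENNReal.ofReal (f x) ^ p ≠ ∞ := by
    refine ne_of_lt (lt_of_le_of_lt (lintegral_mono fun x => ?_) (M_finite hf hs h0 hp))
    dsimp only
    gcongr
    by_contra hcon
    push Not at hcon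
    have hMx : M f x ≠ ∞ := ne_top_of_lt hcon
    have h1 : (M f x).toReal < f x := (ENNReal.lt_ofReal_iff_toReal_lt hMx).1 hcon
    have := (lt_M_iff hf h0 ENNReal.toReal_nonneg x).2 (Or.inr (gt_mem_setR hf _ x h1))
    rw [ENNReal.ofReal_toReal hMx] at this
    exact lt_irrefl _ this
  have hq : p.HolderConjugate (p / (p - 1)) := Real.HolderConjugate.conjExponent hp
  have hH := ENNReal.lintegral_mul_le_Lp_mul_Lq volume hq
    (f := fun x => ENNReal.ofReal (f x)) (g := fun x => M f x ^ (p - 1))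
    hf.measurable.ennreal_ofReal.aemeasurable ((M_measurable hf h0).pow_const _).aemeasurable
  simp only [Pi.mul_apply, ← ENNReal.rpow_mul, mul_div_cancel₀ p hp1.ne'] at hH
  have hst2 := hst.trans (mul_le_mul_right (add_le_add_left hH _) _)
  generalize (∫⁻ x, M f x ^ p) = X at *
  generalize (∫⁻ x, ENNReal.ofReal (f x) ^ p) = Y at *
  obtain ⟨x, hx0, hx⟩ : ∃ x : ℝ, 0 ≤ x ∧ X = ENNReal.ofReal (x ^ p) :=
    ⟨X.toReal ^ (1 / p), by positivity, by
      rw [← Real.rpow_mul ENNReal.toReal_nonneg, one_div_mul_cancel hp0.ne', Real.rpow_one,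
        ENNReal.ofReal_toReal hXf]⟩
  obtain ⟨y, hy0, hy⟩ : ∃ x : ℝ, 0 ≤ x ∧ Y = ENNReal.ofReal (x ^ p) :=
    ⟨Y.toReal ^ (1 / p), by positivity, by
      rw [← Real.rpow_mul ENNReal.toReal_nonneg, one_div_mul_cancel hp0.ne', Real.rpow_one,
        ENNReal.ofReal_toReal hYf]⟩
  have er : ∀ z : ℝ, 0 ≤ z → ENNReal.ofReal (z ^ p) ^ (1 / p) = ENNReal.ofReal z := by
    intro z hz
    rw [ENNReal.ofReal_rpow_of_nonneg (by positivity) (by positivity), ← Real.rpow_mul hz,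
      mul_one_div_cancel hp0.ne', Real.rpow_one]
  have er2 : ENNReal.ofReal (x ^ p) ^ (1 / (p / (p - 1))) = ENNReal.ofReal (x ^ (p - 1)) := by
    rw [ENNReal.ofReal_rpow_of_nonneg (by positivity) (by positivity), ← Real.rpow_mul hx0]
    congr 2; field_simp
  rw [hx, hy, er y hy0, er2, ← ENNReal.ofReal_mul hy0,
    ← ENNReal.ofReal_add (by positivity) (by positivity),
    ← ENNReal.ofReal_add (by positivity) (by positivity),
    ← ENNReal.ofReal_mul hp1.le, ← ENNReal.ofReal_mul hp0.le,
    ENNReal.ofReal_le_ofReal_iff (by positivity)] at hst2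
  rw [hx, hy, er x hx0, er y hy0, ← ENNReal.ofReal_mul hcp.le]
  apply ENNReal.ofReal_le_ofReal
  rcases hy0.eq_or_lt with rfl | hypos
  · rw [Real.zero_rpow hp0.ne'] at hst2
    by_contra hcon
    have hxp : 0 < x := by
      push Not at hcon; linarith
    have : 0 < x ^ p := by positivity
    nlinarith
  · rw [← div_le_iff₀ hypos]
    apply root_le hp hcp hroot
    rw [Real.div_rpow hx0 hy0, Real.div_rpow hx0 hy0]
    have hyp : 0 < y ^ p := by positivity
    have hyp1 : 0 < y ^ (p - 1) := by positivity
    have hyy : y ^ p = y ^ (p - 1) * y := by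
      rw [Real.rpow_sub_one hypos.ne', div_mul_cancel₀ _ hypos.ne']
    have : (p - 1) * (x ^ p / y ^ p) - p * (x ^ (p - 1) / y ^ (p - 1)) - 1 =
        ((p - 1) * (x ^ p + y ^ p) - p * (y * x ^ (p - 1) + y ^ p)) / y ^ p := by
      rw [hyy]; field_simp; ring
    rw [this]
    exact div_nonpos_of_nonpos_of_nonneg (by linarith) hyp.le

lemma tendsto_avg {p : ℝ} (hp : 1 < p) {f : ℝ → ℝ} (hf : MemLp f (ENNReal.ofReal p))
    {g : ℕ → ℝ → ℝ} (hg : ∀ n, Continuous (g n)) {e : ℕ → ℝ≥0∞}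
    (he : Filter.Tendsto e Filter.atTop (nhds 0))
    (hfg : ∀ n, eLpNorm (f - g n) (ENNReal.ofReal p) ≤ e n) {a b : ℝ} (hab : a < b) :
    Filter.Tendsto (fun n => ∫ t in a..b, |g n t|) Filter.atTop (nhds (∫ t in a..b, |f t|)) := by
  simp only [intervalIntegral.integral_of_le hab.le]
  apply tendsto_integral_of_L1 (fun t => |f t|)
  · exact hf.aestronglyMeasurable.norm.restrict
  · refine Filter.Eventually.of_forall fun n => ?_
    have : Continuous fun t => |g n t| := (hg n).abs
    exact (this.intervalIntegrable (μ := volume) a b).1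
  · set K : ℝ≥0∞ := (volume.restrict (Ioc a b) univ) ^
      (1 / (1:ℝ≥0∞).toReal - 1 / (ENNReal.ofReal p).toReal) with hK
    have hKt : K ≠ ∞ := by
      rw [hK]
      apply ENNReal.rpow_ne_top_of_nonneg
      · rw [ENNReal.toReal_ofReal (by linarith)]
        simp
        exact inv_le_one_of_one_le₀ hp.le
      · simp
    have hlim : Filter.Tendsto (fun n => e n * K) Filter.atTop (nhds 0) := by
      simpa using ENNReal.Tendsto.mul_const he (Or.inr hKt)
    refine tendsto_of_tendsto_of_tendsto_of_le_of_le tendsto_const_nhds hlim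
      (fun n => zero_le) (fun n => ?_)
    have hm : AEStronglyMeasurable (f - g n) (volume.restrict (Ioc a b)) :=
      (hf.aestronglyMeasurable.sub (hg n).aestronglyMeasurable).restrict
    calc ∫⁻ t in Ioc a b, ‖|g n t| - |f t|‖ₑ ≤ ∫⁻ t in Ioc a b, ‖(f - g n) t‖ₑ := by
          apply lintegral_mono
          intro t
          dsimp only
          rw [enorm_le_iff_norm_le]
          simp only [Real.norm_eq_abs, Pi.sub_apply]
          rw [abs_sub_comm (f t)]
          exact abs_abs_sub_abs_le_abs_sub _ _
      _ = eLpNorm (f - g n) 1 (volume.restrict (Ioc a b)) := eLpNorm_one_eq_lintegral_enorm.symm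
      _ ≤ eLpNorm (f - g n) (ENNReal.ofReal p) (volume.restrict (Ioc a b)) * K :=
          eLpNorm_le_eLpNorm_mul_rpow_measure_univ (by simpa using hp.le) hm
      _ ≤ e n * K := by
          gcongr
          exact (eLpNorm_mono_measure _ Measure.restrict_le_self).trans (hfg n)

lemma M_abs (f : ℝ → ℝ) : M (fun x => |f x|) = M f := by
  funext x; simp only [M, abs_abs]

lemma eLp_eq {p : ℝ} (hp : 1 < p) (f : ℝ → ℝ) :
    eLpNorm f (ENNReal.ofReal p) = (∫⁻ x, ENNReal.ofReal |f x| ^ p) ^ (1 / p) := by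
  have hp0 : 0 < p := by linarith
  rw [eLpNorm_eq_lintegral_rpow_enorm_toReal (by simpa using hp0) ENNReal.ofReal_ne_top,
    ENNReal.toReal_ofReal hp0.le]
  simp only [Real.enorm_eq_ofReal_abs]

lemma eLp_approx {P e : ℝ≥0∞} (hP : 1 ≤ P) {f g : ℝ → ℝ} (hf : MemLp f P) (hg : MemLp g P)
    (h : eLpNorm (f - g) P volume ≤ e) : eLpNorm g P volume ≤ eLpNorm f P volume + e := by
  have h1 := eLpNorm_sub_le (μ := volume) hf.1 (hf.1.sub hg.1) hP
  rw [sub_sub_cancel] at h1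
  exact h1.trans (add_le_add le_rfl h)

lemma le_M (f : ℝ → ℝ) {a b x : ℝ} (hax : a ≤ x) (hxb : x ≤ b) (hab : a < b) :
    ENNReal.ofReal ((b - a)⁻¹ * ∫ t in a..b, |f t|) ≤ M f x :=
  le_iSup_of_le a (le_iSup_of_le b (le_iSup_of_le hax (le_iSup_of_le hxb
      (le_iSup_of_le hab le_rfl))))

lemma M_le {f : ℝ → ℝ} {x : ℝ} {L : ℝ≥0∞} (h : ∀ a b, a ≤ x → x ≤ b → a < b →
    ENNReal.ofReal ((b - a)⁻¹ * ∫ t in a..b, |f t|) ≤ L) : M f x ≤ L :=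
  iSup_le fun a => iSup_le fun b => iSup_le fun hax => iSup_le fun hxb =>
      iSup_le fun hab => h a b hax hxb hab

lemma M_le_liminf {p : ℝ} (hp : 1 < p) {f : ℝ → ℝ} (hf : MemLp f (ENNReal.ofReal p))
    {g : ℕ → ℝ → ℝ} (hg : ∀ n, Continuous (g n)) {e : ℕ → ℝ≥0∞}
    (he : Filter.Tendsto e Filter.atTop (nhds 0))
    (hfg : ∀ n, eLpNorm (f - g n) (ENNReal.ofReal p) ≤ e n) (x : ℝ) :
    M f x ^ p ≤ Filter.liminf (fun n => M (g n) x ^ p) Filter.atTop := by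
  have hp0 : 0 < p := by linarith
  rw [← ENNReal.le_rpow_inv_iff hp0]
  refine M_le fun a b hax hxb hab => ?_
  rw [ENNReal.le_rpow_inv_iff hp0]
  have ht := ((ENNReal.tendsto_ofReal
      ((tendsto_avg hp hf hg he hfg hab).const_mul (b - a)⁻¹))).ennrpow_const p
  rw [← ht.liminf_eq]
  exact Filter.liminf_le_liminf (Filter.Eventually.of_forall fun n =>
    ENNReal.rpow_le_rpow (le_M (g n) hax hxb hab) hp0.le)

lemma upper {p cp : ℝ} (hp : 1 < p) (hcp : 0 < cp)
    (hroot : (p - 1) * cp ^ p - p * cp ^ (p - 1) - 1 = 0)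
    (f : ℝ → ℝ) (hfm : Measurable f) (hfin : (∫⁻ x, ENNReal.ofReal |f x| ^ p) < ∞) :
    (∫⁻ x, M f x ^ p) ^ (1 / p)
          ≤ ENNReal.ofReal cp * (∫⁻ x, ENNReal.ofReal |f x| ^ p) ^ (1 / p) := by
  have hp0 : 0 < p := by linarith
  have hmem : MemLp f (ENNReal.ofReal p) := by
    refine ⟨hfm.aestronglyMeasurable, ?_⟩
    rw [eLp_eq hp]
    exact ENNReal.rpow_lt_top_of_nonneg (by positivity) hfin.ne
  rw [← eLp_eq hp]
  have hP1 : 1 ≤ ENNReal.ofReal p := by simpa using hp.le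
  obtain ⟨e, he0, he⟩ : ∃ e : ℕ → ℝ≥0∞, (∀ n, e n ≠ 0) ∧
      Filter.Tendsto e Filter.atTop (nhds 0) :=
    ⟨fun n => (n : ℝ≥0∞)⁻¹, fun n => ENNReal.inv_ne_zero.2 (ENNReal.natCast_ne_top n),
      ENNReal.tendsto_inv_nat_nhds_zero⟩
  have hex : ∀ n : ℕ, ∃ g : ℝ → ℝ, HasCompactSupport g ∧
      eLpNorm (f - g) (ENNReal.ofReal p) ≤ e n ∧ Continuous g ∧
      MemLp g (ENNReal.ofReal p) := fun n =>
    hmem.exists_hasCompactSupport_eLpNorm_sub_le ENNReal.ofReal_ne_top (he0 n)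
  choose g hgs hge hgc hgm using hex
  have hMg : ∀ n, Measurable fun x => M (g n) x ^ p := fun n => by
    rw [← M_abs]
    exact (M_measurable (hgc n).abs fun x => abs_nonneg _).pow_const _
  have hbd : ∀ n, ∫⁻ x, M (g n) x ^ p ≤
      (ENNReal.ofReal cp * (eLpNorm f (ENNReal.ofReal p) + e n)) ^ p := by
    intro n
    have h1 := bound_cont hp hcp hroot (f := fun x => |g n x|) (hgc n).abs (hgs n).norm
      (fun x => abs_nonneg _)
    rw [M_abs, ← eLp_eq hp, one_div, ENNReal.rpow_inv_le_iff hp0] at h1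
    refine h1.trans ?_
    gcongr
    exact eLp_approx hP1 hmem (hgm n) (hge n)
  have hlim : Filter.Tendsto (fun n : ℕ =>
      (ENNReal.ofReal cp * (eLpNorm f (ENNReal.ofReal p) + e n)) ^ p)
      Filter.atTop (nhds ((ENNReal.ofReal cp * eLpNorm f (ENNReal.ofReal p)) ^ p)) := by
    have h1 : Filter.Tendsto (fun n : ℕ => eLpNorm f (ENNReal.ofReal p) + e n)
        Filter.atTop (nhds (eLpNorm f (ENNReal.ofReal p) + 0)) := he.const_add _
    rw [add_zero] at h1
    have h2 := ENNReal.Tendsto.const_mul h1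
      (Or.inr (ENNReal.ofReal_ne_top : ENNReal.ofReal cp ≠ ∞))
    exact h2.ennrpow_const p
  have hpt := M_le_liminf hp hmem hgc he hge
  rw [one_div, ENNReal.rpow_inv_le_iff hp0]
  have k1 := lintegral_mono (μ := volume) hpt
  have k2 := lintegral_liminf_le (μ := volume) (u := Filter.atTop) hMg
  have k3 := Filter.liminf_le_liminf (f := Filter.atTop) (Filter.Eventually.of_forall hbd)
  rw [hlim.liminf_eq] at k3
  exact k1.trans (k2.trans k3)

lemma absrpow_int0 {r : ℝ} (hr : -1 < r) {b : ℝ} (hb : 0 ≤ b) :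
    IntervalIntegrable (fun t : ℝ => |t| ^ r) volume 0 b := by
  refine (intervalIntegral.intervalIntegrable_rpow' hr).congr ?_
  intro t ht
  rw [uIoc_of_le hb] at ht
  simp only [abs_of_pos ht.1]

lemma absrpow_int1 {r : ℝ} (hr : -1 < r) {b : ℝ} (hb : 0 ≤ b) :
    IntervalIntegrable (fun t : ℝ => |t| ^ r) volume (-b) 0 := by
  rw [IntervalIntegrable.iff_comp_neg]
  simpa using (absrpow_int0 hr hb).symm

lemma absrpow_val0 {r : ℝ} (hr : -1 < r) {b : ℝ} (hb : 0 ≤ b) :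
    ∫ t in (0:ℝ)..b, |t| ^ r = b ^ (r + 1) / (r + 1) := by
  rw [intervalIntegral.integral_congr (g := fun t => t ^ r), integral_rpow (Or.inl hr),
    Real.zero_rpow (by linarith), sub_zero]
  intro t ht
  rw [uIcc_of_le hb] at ht
  simp only [abs_of_nonneg ht.1]

lemma absrpow_val1 {r : ℝ} (hr : -1 < r) {b : ℝ} (hb : 0 ≤ b) :
    ∫ t in (-b)..(0:ℝ), |t| ^ r = b ^ (r + 1) / (r + 1) := by
  rw [← absrpow_val0 hr hb]
  have := intervalIntegral.integral_comp_neg (a := 0) (b := b) (fun t : ℝ => |t| ^ r)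
  simpa using this.symm

/-- Near-extremal functions. -/
noncomputable def exf (α : ℝ) (t : ℝ) : ℝ := if |t| ≤ 1 then |t| ^ (-α) else 0

/-- The ratio attained by near-extremal functions. -/
noncomputable def ratio (s α : ℝ) : ℝ := (1 + s ^ (1 - α)) / ((1 - α) * (1 + s))

lemma exf_nonneg (α t : ℝ) : 0 ≤ exf α t := by
  unfold exf; split_ifs <;> positivity

lemma exf_int {α a b : ℝ} (hα1 : α < 1) (ha : 0 ≤ a) (hb : 0 ≤ b)
    (ha1 : a ≤ 1) (hb1 : b ≤ 1) :
    ∫ t in (-a)..b, |exf α t| = a ^ (1 - α) / (1 - α) + b ^ (1 - α) / (1 - α) := by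
  have hr : -1 < -α := by linarith
  rw [intervalIntegral.integral_congr (g := fun t => |t| ^ (-α)),
    ← intervalIntegral.integral_add_adjacent_intervals (absrpow_int1 hr ha) (absrpow_int0 hr hb),
    absrpow_val1 hr ha, absrpow_val0 hr hb]
  · ring_nf
  · intro t ht
    rw [uIcc_of_le (by linarith)] at ht
    have : |t| ≤ 1 := abs_le.2 ⟨by linarith [ht.1], by linarith [ht.2]⟩
    simp only [abs_of_nonneg (exf_nonneg α t)]
    simp [exf, this]

lemma exf_M {α s : ℝ} (hα0 : 0 < α) (hα1 : α < 1) (hs0 : 0 < s) (hs1 : s ≤ 1) (x : ℝ) :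
    ENNReal.ofReal (ratio s α) * ENNReal.ofReal |exf α x| ≤ M (exf α) x := by
  rw [abs_of_nonneg (exf_nonneg α x)]
  by_cases hx : |x| ≤ 1
  swap
  · simp [exf, hx]
  rcases eq_or_ne x 0 with rfl | hx0
  · simp [exf, Real.zero_rpow (neg_ne_zero.2 hα0.ne')]
  have hu : 0 < |x| := abs_pos.2 hx0
  have h1α : 0 < 1 - α := by linarith
  have hR : 0 ≤ ratio s α := by unfold ratio; positivity
  have hval : ratio s α * exf α x =
      (|x| + s * |x|)⁻¹ * (|x| ^ (1 - α) / (1 - α) + (s * |x|) ^ (1 - α) / (1 - α)) := by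
    simp only [ratio, exf, hx, if_true]
    rw [Real.mul_rpow hs0.le hu.le, Real.rpow_neg hu.le, Real.rpow_sub hu, Real.rpow_one]
    have : 0 < |x| ^ α := by positivity
    field_simp
  have hsx : s * |x| ≤ 1 := by nlinarith
  have hsx0 : 0 < s * |x| := by positivity
  rw [← ENNReal.ofReal_mul hR, hval]
  unfold M
  rcases lt_or_gt_of_ne hx0 with hneg | hpos
  · have hax : |x| = -x := abs_of_neg hneg
    refine le_iSup_of_le (-|x|) (le_iSup_of_le (s * |x|) (le_iSup_of_le (by linarith)
      (le_iSup_of_le (by linarith) (le_iSup_of_le (by linarith) ?_))))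
    rw [exf_int hα1 hu.le hsx0.le hx hsx]
    apply le_of_eq; congr 2; ring
  · have hax : |x| = x := abs_of_pos hpos
    refine le_iSup_of_le (-(s * |x|)) (le_iSup_of_le (|x|) (le_iSup_of_le (by linarith)
      (le_iSup_of_le (by linarith) (le_iSup_of_le (by linarith) ?_))))
    rw [exf_int hα1 hsx0.le hu.le hsx hx, add_comm (_ / _)]
    apply le_of_eq; congr 2; ring

lemma exf_meas (α : ℝ) : Measurable (exf α) := by
  unfold exf
  exact Measurable.ite (measurableSet_le (by fun_prop) (by fun_prop)) (by fun_prop) (by fun_prop)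

lemma exf_fin {α p : ℝ} (hp : 1 < p) (hα : α < 1 / p) :
    ∫⁻ x, ENNReal.ofReal |exf α x| ^ p < ∞ := by
  have hp0 : 0 < p := by linarith
  have hr : -1 < -(α * p) := by
    rw [lt_div_iff₀ hp0] at hα; linarith
  have h1 := ((absrpow_int1 hr zero_le_one).trans (absrpow_int0 hr zero_le_one))
  rw [intervalIntegrable_iff_integrableOn_Icc_of_le (by norm_num)] at h1
  have e : (fun x => ENNReal.ofReal |exf α x| ^ p) =
      (Icc (-1:ℝ) 1).indicator fun x => ENNReal.ofReal (|x| ^ (-(α * p))) := by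
    funext x
    rw [abs_of_nonneg (exf_nonneg α x),
      ENNReal.ofReal_rpow_of_nonneg (exf_nonneg α x) hp0.le]
    by_cases hx : |x| ≤ 1
    · rw [indicator_of_mem (mem_Icc.2 (abs_le.1 hx))]
      simp only [exf, hx, if_true]
      rw [← Real.rpow_mul (abs_nonneg x)]; ring_nf
    · rw [indicator_of_notMem (fun h => hx (abs_le.2 (mem_Icc.1 h)))]
      simp [exf, hx, Real.zero_rpow hp0.ne']
  rw [e, lintegral_indicator measurableSet_Icc]
  exact h1.lintegral_lt_top

lemma exf_pos {α p : ℝ} (hα : 0 < α) (hp : 1 < p) :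
    ∫⁻ x, ENNReal.ofReal |exf α x| ^ p ≠ 0 := by
  have : (1:ℝ≥0∞) ≤ ∫⁻ x, ENNReal.ofReal |exf α x| ^ p := by
    calc (1:ℝ≥0∞) = ∫⁻ x in Ioc (0:ℝ) 1, 1 := by simp
      _ ≤ ∫⁻ x in Ioc (0:ℝ) 1, ENNReal.ofReal |exf α x| ^ p := by
          apply setLIntegral_mono' measurableSet_Ioc
          intro x hx
          apply ENNReal.one_le_rpow _ (by linarith)
          rw [abs_of_nonneg (exf_nonneg α x), ENNReal.one_le_ofReal]
          have hax : |x| = x := abs_of_pos hx.1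
          simp only [exf, hax, hx.2, if_true]
          exact Real.one_le_rpow_of_pos_of_le_one_of_nonpos hx.1 hx.2 (by linarith)
      _ ≤ _ := setLIntegral_le_lintegral _ _
  intro h
  simp [h] at this

lemma lower {p cp : ℝ} (hp : 1 < p) (hcp : 0 < cp)
    (hroot : (p - 1) * cp ^ p - p * cp ^ (p - 1) - 1 = 0) (c : ℝ) (hc : 0 ≤ c)
    (H : ∀ f : ℝ → ℝ, Measurable f → (∫⁻ x, ENNReal.ofReal |f x| ^ p) < ∞ →
          (∫⁻ x, M f x ^ p) ^ (1 / p)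
            ≤ ENNReal.ofReal c * (∫⁻ x, ENNReal.ofReal |f x| ^ p) ^ (1 / p)) : cp ≤ c := by
  have hp0 : 0 < p := by linarith
  have hp1 : 0 < p - 1 := by linarith
  have hcpp : cp ^ p = cp ^ (p - 1) * cp := by
    rw [Real.rpow_sub_one hcp.ne', div_mul_cancel₀ _ hcp.ne']
  have hA : 0 < cp ^ (p - 1) := by positivity
  have hcp1 : 1 ≤ cp := by
    have h1 : cp ^ (p - 1) * ((p - 1) * cp - p) = 1 := by rw [hcpp] at hroot; linarith
    have h5 : 0 < (p - 1) * cp - p := by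
      by_contra hc
      nlinarith
    by_contra hlt
    push Not at hlt
    nlinarith
  set s : ℝ := cp ^ (-p) with hs
  have hs0 : 0 < s := by positivity
  have hs1 : s ≤ 1 := Real.rpow_le_one_of_one_le_of_nonpos hcp1 (by linarith)
  have hip : 1 / p < 1 := by rw [div_lt_one hp0]; exact hp
  have hle : ∀ α ∈ Ioo 0 (1 / p), ratio s α ≤ c := by
    intro α hα
    have hα1 : α < 1 := hα.2.trans hip
    have h1α : 0 < 1 - α := by linarith
    have hR : 0 ≤ ratio s α := by unfold ratio; positivity
    have hfin := exf_fin hp hα.2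
    have h1 := H (exf α) (exf_meas α) hfin
    set Y := ∫⁻ x, ENNReal.ofReal |exf α x| ^ p with hY
    have h2 : ENNReal.ofReal (ratio s α) * Y ^ (1 / p) ≤ (∫⁻ x, M (exf α) x ^ p) ^ (1 / p) := by
      rw [one_div, ENNReal.le_rpow_inv_iff hp0, ENNReal.mul_rpow_of_nonneg _ _ hp0.le,
        ENNReal.rpow_inv_rpow hp0.ne', hY, ← lintegral_const_mul' _ _
          (ENNReal.rpow_ne_top_of_nonneg hp0.le ENNReal.ofReal_ne_top)]
      apply lintegral_mono
      intro x
      dsimp only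
      rw [← ENNReal.mul_rpow_of_nonneg _ _ hp0.le]
      gcongr
      exact exf_M hα.1 hα1 hs0 hs1 x
    have h3 := h2.trans h1
    have hY0 : Y ^ (1 / p) ≠ 0 := by
      have := exf_pos hα.1 hp
      rw [← hY] at this
      exact fun h => this ((ENNReal.rpow_eq_zero_iff_of_pos (by positivity)).1 h)
    have hYt : Y ^ (1 / p) ≠ ∞ := ENNReal.rpow_ne_top_of_nonneg (by positivity) hfin.ne
    rw [ENNReal.mul_le_mul_iff_left hY0 hYt, ENNReal.ofReal_le_ofReal_iff hc] at h3
    exact h3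
  have hcont : ContinuousAt (ratio s) (1 / p) := by
    unfold ratio
    apply ContinuousAt.div
    · apply ContinuousAt.add continuousAt_const
      exact ContinuousAt.rpow continuousAt_const (by fun_prop) (Or.inl hs0.ne')
    · fun_prop
    · have : 0 < 1 - 1 / p := by linarith
      positivity
  have hval : ratio s (1 / p) = cp := by
    unfold ratio
    have e1 : s ^ (1 - 1 / p) = (cp ^ (p - 1))⁻¹ := by
      rw [hs, ← Real.rpow_mul hcp.le, ← Real.rpow_neg hcp.le]
      congr 1; field_simp
    rw [e1, hs, Real.rpow_neg hcp.le, hcpp]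
    rw [hcpp] at hroot
    have : 0 < 1 - 1 / p := by linarith
    rw [div_eq_iff (by positivity)]
    field_simp
    linarith
  have ht : Filter.Tendsto (ratio s) (nhdsWithin (1 / p) (Iio (1 / p))) (nhds cp) := by
    have := hcont.tendsto.mono_left (nhdsWithin_le_nhds (s := Iio (1 / p)))
    rwa [hval] at this
  refine le_of_tendsto ht ?_
  filter_upwards [Ioo_mem_nhdsLT (show (0:ℝ) < 1 / p by positivity)] with α hα using hle α hα

/-- Main theorem: the operator norm of the uncentered maximal function on
`L^p(ℝ)` is the unique positive root `c_p` of `(p-1)x^p - px^(p-1) - 1 = 0`: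
the bound `‖Mf‖_p ≤ c_p ‖f‖_p` holds and `c_p` is the least such constant. -/
theorem operator_norm_eq (p cp : ℝ) (hp : 1 < p) (hcp : 0 < cp)
    (hroot : (p - 1) * cp ^ p - p * cp ^ (p - 1) - 1 = 0) :
    (∀ f : ℝ → ℝ, Measurable f → (∫⁻ x, ENNReal.ofReal |f x| ^ p) < ∞ →
        (∫⁻ x, M f x ^ p) ^ (1 / p)
          ≤ ENNReal.ofReal cp * (∫⁻ x, ENNReal.ofReal |f x| ^ p) ^ (1 / p))
    ∧ ∀ c : ℝ, 0 ≤ c →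
        (∀ f : ℝ → ℝ, Measurable f → (∫⁻ x, ENNReal.ofReal |f x| ^ p) < ∞ →
          (∫⁻ x, M f x ^ p) ^ (1 / p)
            ≤ ENNReal.ofReal c * (∫⁻ x, ENNReal.ofReal |f x| ^ p) ^ (1 / p)) →
        cp ≤ c := by
  exact ⟨upper hp hcp hroot, lower hp hcp hroot⟩
end

section
/- Upper bound of the main theorem: for 1 < p < ∞ and every f ∈ L^p(ℝ), ‖M f‖_p ≤ c_p ‖f‖_p, where M is the uncentered Hardy–Littlewood maximal function and c_p is the unique positive root of (p-1)x^p − p x^{p-1} − 1 = 0. -/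
open MeasureTheory Set
open scoped ENNReal

def RS (g : ℝ → ℝ) : Set ℝ := {x | ∃ y, x < y ∧ 0 < ∫ t in x..y, g t}

lemma bdd_ii {g : ℝ → ℝ} {K : ℝ} (hg : Measurable g) (hK : ∀ x, |g x| ≤ K) (a b : ℝ) :
    IntervalIntegrable g volume a b := by
  refine (intervalIntegrable_const (c := K)).mono_fun hg.aestronglyMeasurable ?_
  refine Filter.Eventually.of_forall fun x => ?_
  simp only [Real.norm_eq_abs]
  exact (hK x).trans (le_abs_self K)

lemma bdd_li {g : ℝ → ℝ} {K : ℝ} (hg : Measurable g) (hK : ∀ x, |g x| ≤ K) :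
    LocallyIntegrable g volume := by
  refine (locallyIntegrable_const K).mono hg.aestronglyMeasurable ?_
  refine Filter.Eventually.of_forall fun x => ?_
  simp only [Real.norm_eq_abs]
  exact (hK x).trans (le_abs_self K)

lemma rs_isOpen {g : ℝ → ℝ} {K : ℝ} (hg : Measurable g) (hK : ∀ x, |g x| ≤ K) :
    IsOpen (RS g) := by
  have hc : Continuous fun x => ∫ t in (0:ℝ)..x, g t :=
    intervalIntegral.continuous_primitive (fun a b => bdd_ii hg hK a b) 0
  have : RS g = ⋃ y : ℝ, {x | x < y ∧ (∫ t in (0:ℝ)..x, g t) < ∫ t in (0:ℝ)..y, g t} := by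
    ext x
    simp only [RS, mem_ofPred_eq, mem_iUnion]
    refine exists_congr fun y => and_congr_right fun _ => ?_
    rw [← intervalIntegral.integral_interval_sub_left (bdd_ii hg hK 0 y) (bdd_ii hg hK 0 x), sub_pos]
  rw [this]
  exact isOpen_iUnion fun y => (isOpen_Iio).inter (isOpen_lt hc continuous_const)

lemma rising {g : ℝ → ℝ} {K B : ℝ} (hg : Measurable g) (hK : ∀ x, |g x| ≤ K)
    (hB : ∀ x, B < x → g x ≤ 0) (A B' : ℝ) (hBB : B ≤ B') :
    0 ≤ ∫ x in A..B', (RS g).indicator g x := by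
  have hK0 : 0 ≤ K := (abs_nonneg _).trans (hK 0)
  have ii := fun a b => bdd_ii hg hK a b
  set F : ℝ → ℝ := fun x => ∫ t in (0:ℝ)..x, g t with hF
  have hsub : ∀ x y, ∫ t in x..y, g t = F y - F x := fun x y =>
    (intervalIntegral.integral_interval_sub_left (ii 0 y) (ii 0 x)).symm
  have hLip : ∀ x y, |F y - F x| ≤ K * |y - x| := by
    intro x y
    rw [← hsub]
    simpa using intervalIntegral.norm_integral_le_of_norm_le_const (a := x) (b := y) (f := g) (C := K) fun t _ => by simpa using hK t
  have hFl : LipschitzWith K.toNNReal F := by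
    refine LipschitzWith.of_dist_le_mul fun x y => ?_
    rw [Real.dist_eq, Real.dist_eq, Real.coe_toNNReal _ hK0]
    exact hLip y x
  have hanti : ∀ x y, B ≤ x → x ≤ y → F y ≤ F x := by
    intro x y hx hxy
    have : ∫ t in x..y, g t ≤ 0 := by
      have := intervalIntegral.integral_mono_on_of_le_Ioo hxy (ii x y)
        (intervalIntegrable_const (c := (0:ℝ))) (fun t ht => hB t (lt_of_le_of_lt hx ht.1))
      simpa using this
    rw [hsub] at this
    linarith
  have hbd : ∀ x, BddAbove (range fun z : Ici (0:ℝ) => F (x + z)) := by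
    intro x
    refine ⟨F x + K * |B - x|, ?_⟩
    rintro _ ⟨⟨z, hz⟩, rfl⟩
    simp only [mem_Ici] at hz ⊢
    by_cases h : x + z ≤ B
    · have := (le_abs_self _).trans (hLip x (x + z))
      have h2 : |x + z - x| ≤ |B - x| := by
        rw [abs_of_nonneg (by linarith), abs_of_nonneg (by linarith)]; linarith
      have := mul_le_mul_of_nonneg_left h2 hK0
      linarith
    · push Not at h
      have h0 : 0 ≤ K * |B - x| := by positivity
      by_cases h' : B ≤ x
      · have := hanti x (x + z) h' (by linarith)
        linarith
      · have := hanti B (x + z) le_rfl h.le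
        have := (le_abs_self _).trans (hLip x B)
        linarith
  set G : ℝ → ℝ := fun x => ⨆ z : Ici (0:ℝ), F (x + z) with hG
  have hle : ∀ x y, x ≤ y → F y ≤ G x := by
    intro x y hxy
    have := le_ciSup (hbd x) ⟨y - x, by simpa using hxy⟩
    simpa using this
  have hGle : ∀ x c, (∀ y, x ≤ y → F y ≤ c) → G x ≤ c := by
    intro x c h
    exact ciSup_le fun z => h _ (by have := z.2; simp only [mem_Ici] at this; linarith)
  have hGl : LipschitzWith K.toNNReal G := by
    refine LipschitzWith.of_le_add_mul _ fun x y => ?_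
    rw [Real.dist_eq, Real.coe_toNNReal _ hK0]
    refine hGle _ _ fun z hz => ?_
    have h1 := hle y (y + (z - x)) (by linarith)
    have h2 := (le_abs_self _).trans (hLip (y + (z - x)) z)
    have h3 : z - (y + (z - x)) = x - y := by ring
    rw [h3] at h2
    linarith
  have hGanti : Antitone G := fun x y hxy => hGle _ _ fun z hz => hle _ _ (hxy.trans hz)
  have hR : ∀ x, x ∈ RS g ↔ F x < G x := by
    intro x
    constructor
    · rintro ⟨y, hy, h⟩
      rw [hsub] at h
      exact lt_of_lt_of_le (by linarith) (hle x y hy.le)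
    · intro h
      obtain ⟨⟨z, hz⟩, h⟩ := exists_lt_of_lt_ciSup h
      simp only [mem_Ici] at hz h
      refine ⟨x + z, ?_, by rw [hsub]; linarith⟩
      rcases hz.eq_or_lt with rfl | h'
      · simp at h
      · linarith
  set H : ℝ → ℝ := fun x => F x - G x with hH
  have hHl : LipschitzWith (K.toNNReal + K.toNNReal) H := hFl.sub hGl
  have hHac : AbsolutelyContinuousOnInterval H A B' :=
    (hHl.lipschitzOnWith (s := uIcc A B')).absolutelyContinuousOnInterval
  have key : ∀ᵐ x, deriv H x = (RS g).indicator g x := by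
    filter_upwards [LocallyIntegrable.ae_hasDerivAt_integral (bdd_li hg hK), hGl.ae_differentiableAt_real] with x h1 h2
    by_cases hx : x ∈ RS g
    · rw [indicator_of_mem hx]
      have h3 : deriv G x = 0 := by
        apply IsLocalMin.deriv_eq_zero
        have hlt := (hR x).1 hx
        have hev : ∀ᶠ y in nhds x, F y < (F x + G x) / 2 :=
          hFl.continuous.continuousAt.eventually_lt continuousAt_const (by linarith)
        obtain ⟨ε, hε, hball⟩ := Metric.eventually_nhds_iff.1 hev
        refine Metric.eventually_nhds_iff.2 ⟨ε, hε, fun y hy => ?_⟩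
        by_contra! hcon
        have hxy : x < y := by
          by_contra! hyx
          exact absurd (hGanti hyx) (not_le.2 hcon)
        have : G x ≤ max ((F x + G x) / 2) (G y) := by
          refine hGle _ _ fun z hz => ?_
          by_cases hzy : y ≤ z
          · exact (hle y z hzy).trans (le_max_right _ _)
          · push Not at hzy
            refine le_trans (hball ?_).le (le_max_left _ _)
            rw [Real.dist_eq, abs_of_pos (by linarith)] at hy
            rw [Real.dist_eq, abs_of_nonneg (by linarith)]
            linarith
        rcases le_max_iff.1 this with h | h <;> linarith
      have h4 : HasDerivAt H (g x - deriv G x) x := (h1 0).sub h2.hasDerivAt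
      rw [h4.deriv, h3, sub_zero]
    · rw [indicator_of_notMem hx]
      apply IsLocalMax.deriv_eq_zero
      refine Filter.Eventually.of_forall fun y => ?_
      have h3 := hle y y le_rfl
      have h4 : G x ≤ F x := not_lt.1 fun h => hx ((hR x).2 h)
      simp only [hH]
      linarith
  have e1 : ∫ x in A..B', deriv H x = H B' - H A := hHac.integral_deriv_eq_sub
  have e2 : ∫ x in A..B', deriv H x = ∫ x in A..B', (RS g).indicator g x :=
    intervalIntegral.integral_congr_ae (by filter_upwards [key] with x hx _ using hx)
  rw [← e2, e1]
  have h5 : G B' ≤ F B' := hGle _ _ fun z hz => hanti _ _ hBB hz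
  have h6 := hle A A le_rfl
  simp only [hH]
  linarith

def LS (g : ℝ → ℝ) : Set ℝ := {x | ∃ y, y < x ∧ 0 < ∫ t in y..x, g t}

lemma ls_eq (g : ℝ → ℝ) : LS g = Neg.neg ⁻¹' (RS fun x => g (-x)) := by
  ext x
  simp only [LS, RS, mem_ofPred_eq, mem_preimage, intervalIntegral.integral_comp_neg, neg_neg]
  constructor
  · rintro ⟨y, hy, h⟩
    exact ⟨-y, by linarith, by simpa using h⟩
  · rintro ⟨y, hy, h⟩
    exact ⟨-y, by linarith, by simpa using h⟩

lemma ls_isOpen {g : ℝ → ℝ} {K : ℝ} (hg : Measurable g) (hK : ∀ x, |g x| ≤ K) :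
    IsOpen (LS g) := by
  rw [ls_eq]
  exact (rs_isOpen (hg.comp measurable_neg) (fun x => hK (-x))).preimage continuous_neg

/-- nice functions -/
structure Nice (f : ℝ → ℝ) (N : ℝ) : Prop where
  meas : Measurable f
  nonneg : ∀ x, 0 ≤ f x
  le : ∀ x, f x ≤ N
  supp : ∀ x, N < |x| → f x = 0

lemma Nice.sub_meas {f : ℝ → ℝ} {N : ℝ} (h : Nice f N) (t : ℝ) : Measurable fun x => f x - t :=
  h.meas.sub measurable_const

lemma Nice.sub_bdd {f : ℝ → ℝ} {N : ℝ} (h : Nice f N) (t : ℝ) (x : ℝ) :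
    |f x - t| ≤ N + |t| := by
  have h1 := h.nonneg x
  have h2 := h.le x
  refine (abs_sub _ _).trans ?_
  rw [abs_of_nonneg h1]
  linarith

lemma Nice.comp_neg {f : ℝ → ℝ} {N : ℝ} (h : Nice f N) : Nice (fun x => f (-x)) N where
  meas := h.meas.comp measurable_neg
  nonneg x := h.nonneg _
  le x := h.le _
  supp x hx := h.supp _ (by simpa using hx)

lemma Nice.rs_weak {f : ℝ → ℝ} {N : ℝ} (h : Nice f N) {t : ℝ} (ht : 0 < t) :
    ENNReal.ofReal t * volume (RS fun x => f x - t)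
      ≤ ∫⁻ x in (RS fun x => f x - t), ENNReal.ofReal (f x) := by
  have hN : 0 ≤ N := (h.nonneg 0).trans (h.le 0)
  have hms := h.sub_meas t
  have hop := rs_isOpen hms (h.sub_bdd t)
  set R := RS fun x => f x - t with hR
  have hU : R = ⋃ n : ℕ, (R ∩ Ioc (-(n:ℝ)) n) := by
    ext x
    simp only [mem_iUnion, mem_inter_iff, mem_Ioc]
    constructor
    · intro hx
      obtain ⟨n, hn⟩ := exists_nat_gt |x|
      exact ⟨n, hx, (abs_lt.1 hn).1, (abs_lt.1 hn).2.le⟩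
    · rintro ⟨n, hx, _⟩; exact hx
  have hmono : Monotone fun n : ℕ => (R ∩ Ioc (-(n:ℝ)) n) := by
    intro m n hmn
    have : (m:ℝ) ≤ n := by exact_mod_cast hmn
    exact inter_subset_inter_right _ (Ioc_subset_Ioc (by linarith) this)
  have hlim : Filter.Tendsto (fun n : ℕ => ENNReal.ofReal t * volume (R ∩ Ioc (-(n:ℝ)) n))
      Filter.atTop (nhds (ENNReal.ofReal t * volume R)) := by
    refine ENNReal.Tendsto.const_mul ?_ (Or.inr ENNReal.ofReal_ne_top)
    have := tendsto_measure_iUnion_atTop (μ := volume) hmono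
    rwa [← hU] at this
  refine le_of_tendsto hlim ?_
  obtain ⟨n0, hn0⟩ := exists_nat_ge N
  filter_upwards [Filter.eventually_ge_atTop n0] with n hn
  have hn' : N ≤ n := hn0.trans (by exact_mod_cast hn)
  have hnn : -(n:ℝ) ≤ n := by linarith
  have h1 := rising (B := N) hms (h.sub_bdd t)
    (fun x hx => by rw [h.supp x (lt_of_lt_of_le hx (le_abs_self x))]; linarith) (-n) n hn'
  rw [← hR, intervalIntegral.integral_of_le hnn, setIntegral_indicator hop.measurableSet,
    inter_comm] at h1
  have hfin : volume (R ∩ Ioc (-(n:ℝ)) n) < ∞ :=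
    lt_of_le_of_lt (measure_mono inter_subset_right) (by simp)
  have hfi : IntegrableOn f (R ∩ Ioc (-(n:ℝ)) n) := by
    have := bdd_ii (K := N) h.meas (fun x => by rw [abs_of_nonneg (h.nonneg x)]; exact h.le x)
      (-n) n
    exact ((intervalIntegrable_iff_integrableOn_Ioc_of_le hnn).1 this).mono_set inter_subset_right
  rw [integral_sub hfi (integrableOn_const hfin.ne)] at h1
  have h2 : t * volume.real (R ∩ Ioc (-(n:ℝ)) n) ≤ ∫ x in R ∩ Ioc (-(n:ℝ)) n, f x := by
    simp at h1
    linarith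
  have h3 := ENNReal.ofReal_le_ofReal h2
  rw [ofReal_integral_eq_lintegral_ofReal hfi (Filter.Eventually.of_forall h.nonneg),
    ENNReal.ofReal_mul ht.le, ofReal_measureReal hfin.ne] at h3
  exact h3.trans (lintegral_mono_set inter_subset_left)

lemma Nice.ls_weak {f : ℝ → ℝ} {N : ℝ} (h : Nice f N) {t : ℝ} (ht : 0 < t) :
    ENNReal.ofReal t * volume (LS fun x => f x - t)
      ≤ ∫⁻ x in (LS fun x => f x - t), ENNReal.ofReal (f x) := by
  have h1 := h.comp_neg.rs_weak ht
  have hmp := Measure.measurePreserving_neg (volume : Measure ℝ)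
  have hop := rs_isOpen (h.comp_neg.sub_meas t) (h.comp_neg.sub_bdd t)
  rw [ls_eq]
  rw [← hmp.measure_preimage hop.measurableSet.nullMeasurableSet,
    ← hmp.setLIntegral_comp_preimage hop.measurableSet
      (h.comp_neg.meas.ennreal_ofReal)] at h1
  simpa using h1

lemma Nice.ae_sub {f : ℝ → ℝ} {N : ℝ} (h : Nice f N) (t : ℝ) :
    ∀ᵐ x, t < f x → x ∈ (RS fun x => f x - t) ∩ (LS fun x => f x - t) := by
  filter_upwards [LocallyIntegrable.ae_hasDerivAt_integral
    (bdd_li (h.sub_meas t) (h.sub_bdd t))] with x hx hlt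
  have hd := hx x
  have h0 : 0 < f x - t := by linarith
  have hsl := (hasDerivAt_iff_tendsto_slope.1 hd).eventually (lt_mem_nhds h0)
  rw [eventually_nhdsWithin_iff] at hsl
  obtain ⟨ε, hε, hball⟩ := Metric.eventually_nhds_iff.1 hsl
  constructor
  · refine ⟨x + ε / 2, by linarith, ?_⟩
    have := hball (y := x + ε / 2) (by simp [abs_of_pos hε, hε]) (by simp [hε.ne'])
    rw [slope_def_field] at this
    simp only [intervalIntegral.integral_same, sub_zero, add_sub_cancel_left] at this
    exact (div_pos_iff_of_pos_right (by positivity)).1 this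
  · refine ⟨x - ε / 2, by linarith, ?_⟩
    have := hball (y := x - ε / 2) (by simp [abs_of_pos hε, hε]) (by simp [hε.ne'])
    rw [slope_def_field] at this
    simp only [intervalIntegral.integral_same, sub_zero, sub_sub_cancel_left] at this
    rw [intervalIntegral.integral_symm, neg_div_neg_eq] at this
    exact (div_pos_iff_of_pos_right (by positivity)).1 this

lemma Nice.lt_M {f : ℝ → ℝ} {N : ℝ} (h : Nice f N) {t : ℝ} (ht : 0 ≤ t) :
    {x | ENNReal.ofReal t < M f x} = (RS fun x => f x - t) ∪ (LS fun x => f x - t) := by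
  have ii := fun a b => bdd_ii (h.sub_meas t) (h.sub_bdd t) a b
  have iif := fun a b => bdd_ii (K := N) h.meas
    (fun x => by rw [abs_of_nonneg (h.nonneg x)]; exact h.le x) a b
  have hav : ∀ a b, a < b → (ENNReal.ofReal t < ENNReal.ofReal ((b - a)⁻¹ * ∫ t in a..b, |f t|) ↔
      0 < ∫ x in a..b, (f x - t)) := by
    intro a b hab
    rw [ENNReal.ofReal_lt_ofReal_iff_of_nonneg ht]
    rw [intervalIntegral.integral_sub (iif a b) intervalIntegrable_const]
    simp only [abs_of_nonneg (h.nonneg _), intervalIntegral.integral_const, smul_eq_mul]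
    rw [lt_inv_mul_iff₀ (by linarith), sub_pos]
  ext x
  simp only [mem_ofPred_eq, mem_union, M, lt_iSup_iff]
  constructor
  · rintro ⟨a, b, hax, hxb, hab, hlt⟩
    rw [hav a b hab, ← intervalIntegral.integral_add_adjacent_intervals (ii a x) (ii x b)] at hlt
    by_cases h1 : 0 < ∫ y in x..b, (f y - t)
    · left
      refine ⟨b, lt_of_le_of_ne hxb ?_, h1⟩
      rintro rfl; simp at h1
    · right
      have h2 : 0 < ∫ y in a..x, (f y - t) := by linarith
      refine ⟨a, lt_of_le_of_ne hax ?_, h2⟩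
      rintro rfl; simp at h2
  · rintro (⟨y, hy, h1⟩ | ⟨y, hy, h1⟩)
    · exact ⟨x, y, le_rfl, hy.le, hy, (hav _ _ hy).2 h1⟩
    · exact ⟨y, x, hy.le, le_rfl, hy, (hav _ _ hy).2 h1⟩

lemma Nice.weak {f : ℝ → ℝ} {N : ℝ} (h : Nice f N) {t : ℝ} (ht : 0 < t) :
    ENNReal.ofReal t * (volume {x | ENNReal.ofReal t < M f x} + volume {x | t < f x})
      ≤ (∫⁻ x in {x | ENNReal.ofReal t < M f x}, ENNReal.ofReal (f x)) +
        ∫⁻ x in {x | t < f x}, ENNReal.ofReal (f x) := by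
  rw [h.lt_M ht.le]
  have hR := h.rs_weak ht
  have hL := h.ls_weak ht
  have hRm := (rs_isOpen (h.sub_meas t) (h.sub_bdd t)).measurableSet
  have hLm := (ls_isOpen (h.sub_meas t) (h.sub_bdd t)).measurableSet
  have hae := h.ae_sub t
  set R := RS fun x => f x - t
  set L := LS fun x => f x - t
  set E := {x | t < f x} with hE
  have hEm : MeasurableSet E := measurableSet_lt measurable_const h.meas
  have hfm : Measurable fun x => ENNReal.ofReal (f x) := h.meas.ennreal_ofReal
  let ν : Measure ℝ := volume.withDensity fun x => ENNReal.ofReal (f x)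
  have hν : ∀ S, MeasurableSet S → ν S = ∫⁻ x in S, ENNReal.ofReal (f x) := fun S hS =>
    withDensity_apply _ hS
  have hac : ν ≪ volume := withDensity_absolutelyContinuous _ _
  rw [← hν _ hRm] at hR
  rw [← hν _ hLm] at hL
  rw [← hν _ (hRm.union hLm), ← hν _ hEm]
  set D := (R ∩ L) \ E with hD
  have hDm : MeasurableSet D := (hRm.inter hLm).diff hEm
  have hsplit : (R ∩ L : Set ℝ) =ᵐ[volume] (E ∪ D : Set ℝ) := by
    filter_upwards [hae] with x hx
    apply propext
    change (x ∈ R ∩ L) ↔ x ∈ E ∪ D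
    simp only [hD, mem_union, mem_sdiff]
    constructor
    · intro h1; by_cases hxE : x ∈ E
      · exact Or.inl hxE
      · exact Or.inr ⟨h1, hxE⟩
    · rintro (h1 | h1)
      · exact hx h1
      · exact h1.1
  have hdisj : Disjoint E D := disjoint_sdiff_right
  have e1 : volume (R ∩ L) = volume E + volume D := by
    rw [measure_congr hsplit, measure_union hdisj hDm]
  have e2 : ν (R ∩ L) = ν E + ν D := by
    rw [measure_congr (hac.ae_eq hsplit), measure_union hdisj hDm]
  have hDle : ν D ≤ ENNReal.ofReal t * volume D := by
    rw [hν _ hDm]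
    calc ∫⁻ x in D, ENNReal.ofReal (f x) ≤ ∫⁻ x in D, ENNReal.ofReal t := by
          refine setLIntegral_mono measurable_const fun x hx => ENNReal.ofReal_le_ofReal ?_
          exact not_lt.1 hx.2
      _ = _ := by simp
  have hfin : ENNReal.ofReal t * volume D ≠ ∞ := by
    refine ne_top_of_le_ne_top ?_ (le_trans (mul_le_mul_right (measure_mono
      (sdiff_subset.trans inter_subset_left)) _) hR)
    have hNN : ν R ≤ ENNReal.ofReal N * volume (Icc (-N) N) := by
      rw [hν _ hRm]
      calc ∫⁻ x in R, ENNReal.ofReal (f x) ≤ ∫⁻ x, ENNReal.ofReal (f x) := setLIntegral_le_lintegral _ _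
        _ ≤ ∫⁻ x, (Icc (-N) N).indicator (fun _ => ENNReal.ofReal N) x := by
            refine lintegral_mono fun x => ?_
            by_cases hx : x ∈ Icc (-N) N
            · simpa [hx] using ENNReal.ofReal_le_ofReal (h.le x)
            · rw [h.supp x (by by_contra! hc; exact hx (abs_le.1 hc))]; simp
        _ = _ := by rw [lintegral_indicator measurableSet_Icc]; simp
    refine ne_top_of_le_ne_top ?_ hNN
    rw [Real.volume_Icc]
    exact ENNReal.mul_ne_top ENNReal.ofReal_ne_top ENNReal.ofReal_ne_top
  refine (ENNReal.add_le_add_iff_right hfin).1 ?_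
  calc ENNReal.ofReal t * (volume (R ∪ L) + volume E) + ENNReal.ofReal t * volume D
      = ENNReal.ofReal t * (volume (R ∪ L) + volume (R ∩ L)) := by rw [e1]; ring
    _ = ENNReal.ofReal t * volume R + ENNReal.ofReal t * volume L := by
        rw [measure_union_add_inter _ hLm]; ring
    _ ≤ ν R + ν L := add_le_add hR hL
    _ = ν (R ∪ L) + ν (R ∩ L) := (measure_union_add_inter _ hLm).symm
    _ = ν (R ∪ L) + ν E + ν D := by rw [e2]; ring
    _ ≤ _ := by gcongr

lemma Nice.M_le {f : ℝ → ℝ} {N : ℝ} (h : Nice f N) (x : ℝ) :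
    M f x ≤ ENNReal.ofReal ((N * (1 + N) + 2 * N ^ 2) * (1 + |x|)⁻¹) := by
  have hN : 0 ≤ N := (h.nonneg 0).trans (h.le 0)
  have hb : ∀ x, |f x| ≤ N := fun x => by rw [abs_of_nonneg (h.nonneg x)]; exact h.le x
  simp only [M, iSup_le_iff]
  intro a b hax hxb hab
  refine ENNReal.ofReal_le_ofReal ?_
  have hL : 0 < b - a := by linarith
  set I := ∫ t in a..b, |f t| with hI
  have hI0 : 0 ≤ I := intervalIntegral.integral_nonneg hab.le fun t _ => abs_nonneg _
  have hI1 : I ≤ N * (b - a) := by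
    have := intervalIntegral.norm_integral_le_of_norm_le_const (a := a) (b := b)
      (f := fun t => |f t|) (C := N) (fun t _ => by simpa using hb t)
    rw [abs_of_pos hL] at this
    exact (le_abs_self _).trans this
  have hI2 : I ≤ 2 * N ^ 2 := by
    have hint : Integrable ((Icc (-N) N).indicator fun _ : ℝ => N) :=
      (integrable_indicator_iff measurableSet_Icc).2 (integrableOn_const (by simp))
    have hle : ∀ t, |f t| ≤ (Icc (-N) N).indicator (fun _ : ℝ => N) t := by
      intro t
      by_cases ht : t ∈ Icc (-N) N
      · simpa [ht] using hb t
      · rw [h.supp t (by by_contra! hc; exact ht (abs_le.1 hc))]; simp [ht]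
    have hfi : Integrable fun t => |f t| :=
      hint.mono' h.meas.abs.aestronglyMeasurable
        (Filter.Eventually.of_forall fun t => by simpa using hle t)
    rw [hI, intervalIntegral.integral_of_le hab.le]
    calc ∫ t in Ioc a b, |f t| ≤ ∫ t, |f t| :=
          setIntegral_le_integral hfi (Filter.Eventually.of_forall fun t => abs_nonneg _)
      _ ≤ ∫ t, (Icc (-N) N).indicator (fun _ : ℝ => N) t := integral_mono hfi hint hle
      _ = 2 * N ^ 2 := by
          rw [integral_indicator measurableSet_Icc]
          simp [hN]
          ring
  have hI3 : I * |x| ≤ I * (N + (b - a)) := by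
    by_cases hx : |x| ≤ N + (b - a)
    · exact mul_le_mul_of_nonneg_left hx hI0
    · push Not at hx
      have : I = 0 := by
        rw [hI]
        have : ∫ t in a..b, |f t| = ∫ t in a..b, (0:ℝ) := by
          refine intervalIntegral.integral_congr fun t ht => ?_
          rw [uIcc_of_le hab.le] at ht
          have h1 : |x| - |t| ≤ |x - t| := abs_sub_abs_le_abs_sub x t
          have h2 : |x - t| ≤ b - a := abs_le.2 ⟨by linarith [ht.1, ht.2], by linarith [ht.1, ht.2]⟩
          simp [h.supp t (by linarith)]
        rw [this]; simp
      simp [this]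
  rw [inv_mul_le_iff₀ hL, ← mul_assoc, ← div_eq_mul_inv, le_div_iff₀ (by positivity)]
  have h4 : I * (1 + N) ≤ N * (b - a) * (1 + N) := mul_le_mul_of_nonneg_right hI1 (by linarith)
  have h5 : I * (b - a) ≤ 2 * N ^ 2 * (b - a) := mul_le_mul_of_nonneg_right hI2 hL.le
  linarith

lemma Nice.M_meas {f : ℝ → ℝ} {N : ℝ} (h : Nice f N) : Measurable (M f) := by
  have : Measurable fun x => (M f x).toReal := by
    refine measurable_of_Ioi fun t => ?_
    have e : ∀ x, M f x ≠ ∞ := fun x => ne_top_of_le_ne_top ENNReal.ofReal_ne_top (h.M_le x)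
    rcases lt_or_ge t 0 with ht | ht
    · convert MeasurableSet.univ
      ext x
      simp only [mem_preimage, mem_Ioi, mem_univ, iff_true]
      exact lt_of_lt_of_le ht ENNReal.toReal_nonneg
    · have : (fun x => (M f x).toReal) ⁻¹' Ioi t = {x | ENNReal.ofReal t < M f x} := by
        ext x
        simp only [mem_preimage, mem_Ioi, mem_ofPred_eq]
        exact (ENNReal.ofReal_lt_iff_lt_toReal ht (e x)).symm
      rw [this, h.lt_M ht]
      exact ((rs_isOpen (h.sub_meas t) (h.sub_bdd t)).union
        (ls_isOpen (h.sub_meas t) (h.sub_bdd t))).measurableSet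
  have h2 : M f = fun x => ENNReal.ofReal (M f x).toReal := by
    ext x
    rw [ENNReal.ofReal_toReal (ne_top_of_le_ne_top ENNReal.ofReal_ne_top (h.M_le x))]
  rw [h2]
  exact this.ennreal_ofReal

lemma Nice.M_fin {f : ℝ → ℝ} {N : ℝ} (h : Nice f N) {p : ℝ} (hp : 1 < p) :
    ∫⁻ x, M f x ^ p ≠ ∞ := by
  have hN : 0 ≤ N := (h.nonneg 0).trans (h.le 0)
  set C := N * (1 + N) + 2 * N ^ 2 with hC
  have hC0 : 0 ≤ C := by positivity
  have hle : ∫⁻ x, M f x ^ p ≤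
      ENNReal.ofReal (C ^ p) * ∫⁻ x : ℝ, ENNReal.ofReal ((1 + ‖x‖) ^ (-p)) := by
    rw [← lintegral_const_mul' _ _ ENNReal.ofReal_ne_top]
    refine lintegral_mono fun x => ?_
    refine (ENNReal.rpow_le_rpow (h.M_le x) (by linarith)).trans ?_
    rw [ENNReal.ofReal_rpow_of_nonneg (by positivity) (by linarith), ← ENNReal.ofReal_mul (by positivity)]
    apply le_of_eq
    congr 1
    rw [Real.mul_rpow hC0 (by positivity), Real.inv_rpow (by positivity),
      Real.rpow_neg (by positivity)]
    rfl
  refine ne_top_of_le_ne_top (ENNReal.mul_ne_top ENNReal.ofReal_ne_top ?_) hle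
  exact (finite_integral_one_add_norm (by simpa using hp)).ne

lemma Nice.f_fin {f : ℝ → ℝ} {N : ℝ} (h : Nice f N) {p : ℝ} (hp : 1 < p) :
    ∫⁻ x, ENNReal.ofReal (f x) ^ p ≠ ∞ := by
  have hle : ∫⁻ x, ENNReal.ofReal (f x) ^ p ≤
      ∫⁻ x, (Icc (-N) N).indicator (fun _ => ENNReal.ofReal N ^ p) x := by
    refine lintegral_mono fun x => ?_
    by_cases hx : x ∈ Icc (-N) N
    · simpa [hx] using ENNReal.rpow_le_rpow (ENNReal.ofReal_le_ofReal (h.le x)) (by linarith)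
    · rw [h.supp x (by by_contra! hc; exact hx (abs_le.1 hc))]
      simp [show 0 < p by linarith]
  refine ne_top_of_le_ne_top ?_ hle
  rw [lintegral_indicator measurableSet_Icc]
  simp only [lintegral_const, Measure.restrict_apply_univ, Real.volume_Icc]
  exact ENNReal.mul_ne_top (ENNReal.rpow_ne_top_of_nonneg (by linarith) ENNReal.ofReal_ne_top)
    ENNReal.ofReal_ne_top

lemma meas_dist (μ : Measure ℝ) (g : ℝ → ℝ) : Measurable fun t : ℝ => μ {a | t < g a} := by
  refine Antitone.measurable fun s t hst => measure_mono fun x hx => ?_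
  exact lt_of_le_of_lt hst hx

lemma Nice.main_ineq {f : ℝ → ℝ} {N : ℝ} (h : Nice f N) {p : ℝ} (hp : 1 < p) :
    ENNReal.ofReal (p - 1) * ((∫⁻ x, M f x ^ p) + ∫⁻ x, ENNReal.ofReal (f x) ^ p) ≤
      ENNReal.ofReal p * ((∫⁻ x, ENNReal.ofReal (f x) * M f x ^ (p - 1)) +
        ∫⁻ x, ENNReal.ofReal (f x) ^ p) := by
  have hp0 : 0 < p := by linarith
  have hp1 : 0 < p - 1 := by linarith
  set g : ℝ → ℝ := fun x => (M f x).toReal with hg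
  have e : ∀ x, M f x ≠ ∞ := fun x => ne_top_of_le_ne_top ENNReal.ofReal_ne_top (h.M_le x)
  have hgM : ∀ x, M f x = ENNReal.ofReal (g x) := fun x => (ENNReal.ofReal_toReal (e x)).symm
  have hg0 : ∀ x, 0 ≤ g x := fun x => ENNReal.toReal_nonneg
  have hgm : Measurable g := h.M_meas.ennreal_toReal
  have hfm0 : Measurable f := h.meas
  have hfm : Measurable fun x => ENNReal.ofReal (f x) := h.meas.ennreal_ofReal
  let ν : Measure ℝ := volume.withDensity fun x => ENNReal.ofReal (f x)
  have hν : ∀ S, MeasurableSet S → ν S = ∫⁻ x in S, ENNReal.ofReal (f x) := fun S hS =>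
    withDensity_apply _ hS
  have a1 := lintegral_rpow_eq_lintegral_meas_lt_mul volume
    (Filter.Eventually.of_forall hg0) hgm.aemeasurable hp0
  have a2 := lintegral_rpow_eq_lintegral_meas_lt_mul volume
    (Filter.Eventually.of_forall h.nonneg) h.meas.aemeasurable hp0
  have a3 := lintegral_rpow_eq_lintegral_meas_lt_mul ν
    (Filter.Eventually.of_forall hg0) hgm.aemeasurable hp1
  have a4 := lintegral_rpow_eq_lintegral_meas_lt_mul ν
    (Filter.Eventually.of_forall h.nonneg) h.meas.aemeasurable hp1
  rw [lintegral_withDensity_eq_lintegral_mul _ hfm (by fun_prop)] at a3 a4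
  have b1 : ∫⁻ x, M f x ^ p = ∫⁻ x, ENNReal.ofReal (g x ^ p) := by
    refine lintegral_congr fun x => ?_
    rw [hgM, ENNReal.ofReal_rpow_of_nonneg (hg0 x) hp0.le]
  have b2 : ∫⁻ x, ENNReal.ofReal (f x) ^ p = ∫⁻ x, ENNReal.ofReal (f x ^ p) := by
    refine lintegral_congr fun x => ?_
    rw [ENNReal.ofReal_rpow_of_nonneg (h.nonneg x) hp0.le]
  have b3 : ∫⁻ x, ENNReal.ofReal (f x) * M f x ^ (p - 1) =
      ∫⁻ x, ((fun x => ENNReal.ofReal (f x)) * fun x => ENNReal.ofReal (g x ^ (p - 1))) x := by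
    refine lintegral_congr fun x => ?_
    rw [hgM, ENNReal.ofReal_rpow_of_nonneg (hg0 x) hp1.le]
    rfl
  have b4 : ∫⁻ x, ENNReal.ofReal (f x) ^ p =
      ∫⁻ x, ((fun x => ENNReal.ofReal (f x)) * fun x => ENNReal.ofReal (f x ^ (p - 1))) x := by
    refine lintegral_congr fun x => ?_
    simp only [Pi.mul_apply]
    rw [← ENNReal.ofReal_mul (h.nonneg x), ENNReal.ofReal_rpow_of_nonneg (h.nonneg x) hp0.le]
    congr 1
    rcases (h.nonneg x).eq_or_lt with h0 | h0
    · rw [← h0]; simp [hp0.ne']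
    · rw [Real.rpow_sub_one h0.ne']; field_simp
  have hmain : (∫⁻ t in Ioi (0:ℝ), volume {a | t < g a} * ENNReal.ofReal (t ^ (p - 1))) +
      (∫⁻ t in Ioi (0:ℝ), volume {a | t < f a} * ENNReal.ofReal (t ^ (p - 1))) ≤
      (∫⁻ t in Ioi (0:ℝ), ν {a | t < g a} * ENNReal.ofReal (t ^ (p - 1 - 1))) +
      (∫⁻ t in Ioi (0:ℝ), ν {a | t < f a} * ENNReal.ofReal (t ^ (p - 1 - 1))) := by
    have hpm : ∀ q : ℝ, Measurable fun t : ℝ => ENNReal.ofReal (t ^ q) := fun q => by fun_prop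
    have m1 : Measurable fun t => volume {a | t < g a} * ENNReal.ofReal (t ^ (p - 1)) :=
      (meas_dist volume g).mul (hpm _)
    have m2 : Measurable fun t => ν {a | t < g a} * ENNReal.ofReal (t ^ (p - 1 - 1)) :=
      (meas_dist ν g).mul (hpm _)
    rw [← lintegral_add_left m1, ← lintegral_add_left m2]
    refine setLIntegral_mono' measurableSet_Ioi fun t ht => ?_
    simp only [mem_Ioi] at ht
    have hset : {a | t < g a} = {x | ENNReal.ofReal t < M f x} := by
      ext x
      exact (ENNReal.ofReal_lt_iff_lt_toReal ht.le (e x)).symm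
    have hw := h.weak ht
    have hm1 : MeasurableSet {x | ENNReal.ofReal t < M f x} :=
      measurableSet_lt measurable_const h.M_meas
    rw [← hν _ hm1, ← hν _ (measurableSet_lt measurable_const h.meas), ← hset] at hw
    rw [← add_mul, ← add_mul]
    have hpow : ENNReal.ofReal (t ^ (p - 1)) = ENNReal.ofReal t * ENNReal.ofReal (t ^ (p - 1 - 1)) := by
      rw [← ENNReal.ofReal_mul ht.le]
      congr 1
      rw [Real.rpow_sub_one ht.ne' (p - 1)]; field_simp
    rw [hpow, ← mul_assoc, mul_comm _ (ENNReal.ofReal t)]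
    exact mul_le_mul_left hw _
  calc _ = ENNReal.ofReal (p - 1) * (ENNReal.ofReal p * _ + ENNReal.ofReal p * _) := by
        rw [b1, b2, a1, a2]
    _ = (ENNReal.ofReal p * ENNReal.ofReal (p - 1)) * (_ + _) := by
        rw [← mul_add, ← mul_assoc, mul_comm (ENNReal.ofReal (p - 1))]
    _ ≤ (ENNReal.ofReal p * ENNReal.ofReal (p - 1)) * (_ + _) := mul_le_mul_right hmain _
    _ = _ := by
        rw [b3, b4, a3, a4, ← mul_add, ← mul_assoc]

lemma scalar {p c x y : ℝ} (hp : 1 < p) (hc : 0 < c)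
    (hroot : (p - 1) * c ^ p - p * c ^ (p - 1) - 1 = 0) (hx : 0 ≤ x) (hy : 0 ≤ y)
    (h : (p - 1) * (x ^ p + y ^ p) ≤ p * (y * x ^ (p - 1) + y ^ p)) : x ≤ c * y := by
  by_contra! hlt
  have hp1 : 0 < p - 1 := by linarith
  have hx0 : 0 < x := lt_of_le_of_lt (by positivity) hlt
  have hxp : x ^ p = x * x ^ (p - 1) := by rw [Real.rpow_sub_one hx0.ne']; field_simp
  have hcp : c ^ p = c * c ^ (p - 1) := by rw [Real.rpow_sub_one hc.ne']; field_simp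
  have hcpos : 0 < c ^ (p - 1) := Real.rpow_pos_of_pos hc _
  have hxpos : 0 < x ^ (p - 1) := Real.rpow_pos_of_pos hx0 _
  rcases hy.eq_or_lt with hy0 | hy0
  · rw [← hy0, Real.zero_rpow (by linarith)] at h
    have : 0 < (p - 1) * x ^ p := mul_pos hp1 (Real.rpow_pos_of_pos hx0 _)
    linarith
  · have hyp : y ^ p = y * y ^ (p - 1) := by rw [Real.rpow_sub_one hy0.ne']; field_simp
    have hypos : 0 < y ^ (p - 1) := Real.rpow_pos_of_pos hy0 _
    rw [hcp] at hroot
    rw [hxp, hyp] at h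
    have hk : c ^ (p - 1) * ((p - 1) * c - p) = 1 := by linarith
    have hk0 : 0 < (p - 1) * c - p := by
      by_contra! hcon
      have := mul_nonpos_of_nonneg_of_nonpos hcpos.le hcon
      linarith
    have h1 : (c * y) ^ (p - 1) < x ^ (p - 1) := Real.rpow_lt_rpow (by positivity) hlt hp1
    rw [Real.mul_rpow hc.le hy0.le] at h1
    have h2 : ((p - 1) * c - p) * y < (p - 1) * x - p * y := by nlinarith
    have h3 : x ^ (p - 1) * ((p - 1) * x - p * y) ≤ y * y ^ (p - 1) := by linarith
    have h4 : c ^ (p - 1) * y ^ (p - 1) * (((p - 1) * c - p) * y) <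
        x ^ (p - 1) * ((p - 1) * x - p * y) :=
      mul_lt_mul h1 h2.le (by positivity) hxpos.le
    have h5 : c ^ (p - 1) * y ^ (p - 1) * (((p - 1) * c - p) * y) = y * y ^ (p - 1) := by
      calc _ = (c ^ (p - 1) * ((p - 1) * c - p)) * (y * y ^ (p - 1)) := by ring
        _ = _ := by rw [hk, one_mul]
    linarith

lemma Nice.bound {f : ℝ → ℝ} {N : ℝ} (h : Nice f N) {p c : ℝ} (hp : 1 < p) (hc : 0 < c)
    (hroot : (p - 1) * c ^ p - p * c ^ (p - 1) - 1 = 0) :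
    (∫⁻ x, M f x ^ p) ^ (1 / p)
      ≤ ENNReal.ofReal c * (∫⁻ x, ENNReal.ofReal (f x) ^ p) ^ (1 / p) := by
  have hp0 : 0 < p := by linarith
  have hp1 : 0 < p - 1 := by linarith
  have hm := h.main_ineq hp
  have hX := h.M_fin hp
  have hY := h.f_fin hp
  have hfm : Measurable fun x => ENNReal.ofReal (f x) := h.meas.ennreal_ofReal
  have hol := ENNReal.lintegral_mul_le_Lp_mul_Lq volume (Real.HolderConjugate.conjExponent hp)
    hfm.aemeasurable (h.M_meas.pow_const (p - 1)).aemeasurable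
  have hq : ∀ x, (M f x ^ (p - 1)) ^ (p.conjExponent) = M f x ^ p := by
    intro x
    rw [← ENNReal.rpow_mul, Real.conjExponent]
    congr 1
    field_simp
  simp only [Pi.mul_apply, hq] at hol
  set X := ∫⁻ x, M f x ^ p
  set Y := ∫⁻ x, ENNReal.ofReal (f x) ^ p
  have hm2 : ENNReal.ofReal (p - 1) * (X + Y) ≤
      ENNReal.ofReal p * (Y ^ (1 / p) * X ^ (1 / p.conjExponent) + Y) :=
    hm.trans (by gcongr)
  set a := X ^ (1 / p) with ha
  set b := Y ^ (1 / p) with hb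
  have hXa : X = a ^ p := by rw [ha, ← ENNReal.rpow_mul]; field_simp; simp
  have hYb : Y = b ^ p := by rw [hb, ← ENNReal.rpow_mul]; field_simp; simp
  have hXq : X ^ (1 / p.conjExponent) = a ^ (p - 1) := by
    rw [ha, ← ENNReal.rpow_mul, Real.conjExponent]
    congr 1
    field_simp
  have hat : a ≠ ∞ := ENNReal.rpow_ne_top_of_nonneg (by positivity) hX
  have hbt : b ≠ ∞ := ENNReal.rpow_ne_top_of_nonneg (by positivity) hY
  rw [hXq, hXa, hYb] at hm2
  have hx0 : 0 ≤ a.toReal := ENNReal.toReal_nonneg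
  have hy0 : 0 ≤ b.toReal := ENNReal.toReal_nonneg
  rw [← ENNReal.ofReal_toReal hat, ← ENNReal.ofReal_toReal hbt] at hm2 ⊢
  rw [ENNReal.ofReal_rpow_of_nonneg hx0 hp0.le, ENNReal.ofReal_rpow_of_nonneg hy0 hp0.le,
    ENNReal.ofReal_rpow_of_nonneg hx0 hp1.le, ← ENNReal.ofReal_mul hy0,
    ← ENNReal.ofReal_add (by positivity) (by positivity),
    ← ENNReal.ofReal_add (by positivity) (by positivity),
    ← ENNReal.ofReal_mul hp1.le, ← ENNReal.ofReal_mul hp0.le,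
    ENNReal.ofReal_le_ofReal_iff (by positivity)] at hm2
  rw [← ENNReal.ofReal_mul hc.le]
  exact ENNReal.ofReal_le_ofReal (scalar hp hc hroot hx0 hy0 hm2)

noncomputable def tr (f : ℝ → ℝ) (n : ℕ) : ℝ → ℝ :=
  (Icc (-(n:ℝ)) n).indicator fun x => min |f x| n

lemma tr_nonneg (f : ℝ → ℝ) (n : ℕ) (x : ℝ) : 0 ≤ tr f n x :=
  indicator_nonneg (fun x _ => le_min (abs_nonneg _) n.cast_nonneg) x

lemma tr_nice {f : ℝ → ℝ} (hm : Measurable f) (n : ℕ) : Nice (tr f n) n where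
  meas := (hm.abs.min measurable_const).indicator measurableSet_Icc
  nonneg := tr_nonneg f n
  le x := indicator_le' (fun _ _ => min_le_right _ _) (fun _ _ => n.cast_nonneg) x
  supp x hx := by
    have hx' : x ∉ Icc (-(n:ℝ)) n := fun h => absurd (abs_le.2 h) (not_le.2 hx)
    simp only [tr, indicator_of_notMem hx']

lemma tr_le (f : ℝ → ℝ) (n : ℕ) (x : ℝ) : tr f n x ≤ |f x| :=
  indicator_le' (g := fun x => |f x|) (fun _ _ => min_le_left _ _) (fun _ _ => abs_nonneg _) x

lemma tr_mono (f : ℝ → ℝ) {m n : ℕ} (hmn : m ≤ n) (x : ℝ) : tr f m x ≤ tr f n x := by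
  have hmn' : (m:ℝ) ≤ n := by exact_mod_cast hmn
  by_cases hx : x ∈ Icc (-(m:ℝ)) m
  · have hx' : x ∈ Icc (-(n:ℝ)) n := Icc_subset_Icc (by linarith) hmn' hx
    simp only [tr, indicator_of_mem hx, indicator_of_mem hx']
    exact min_le_min_left _ hmn'
  · simp only [tr, indicator_of_notMem hx]
    exact tr_nonneg f n x

lemma tr_tendsto (f : ℝ → ℝ) (x : ℝ) :
    Filter.Tendsto (fun n => tr f n x) Filter.atTop (nhds |f x|) := by
  obtain ⟨n0, hn0⟩ := exists_nat_ge (max |x| |f x|)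
  refine tendsto_const_nhds.congr' ?_
  filter_upwards [Filter.eventually_ge_atTop n0] with n hn
  have h : max |x| |f x| ≤ n := hn0.trans (by exact_mod_cast hn)
  have hx : x ∈ Icc (-(n:ℝ)) n := abs_le.1 ((le_max_left _ _).trans h)
  simp only [tr, indicator_of_mem hx]
  exact (min_eq_left ((le_max_right _ _).trans h)).symm

lemma tr_ii {f : ℝ → ℝ} (hm : Measurable f) (n : ℕ) (a b : ℝ) :
    IntervalIntegrable (tr f n) volume a b :=
  bdd_ii (K := n) (tr_nice hm n).meas
    (fun x => by rw [abs_of_nonneg (tr_nonneg f n x)]; exact (tr_nice hm n).le x) a b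

lemma M_tr_mono {f : ℝ → ℝ} (hm : Measurable f) : Monotone fun n => M (tr f n) := by
  intro m n hmn x
  refine iSup_mono fun a => iSup_mono fun b => iSup_mono fun _ => iSup_mono fun _ =>
    iSup_mono fun hab => ENNReal.ofReal_le_ofReal ?_
  refine mul_le_mul_of_nonneg_left ?_ (inv_nonneg.2 (by linarith))
  simp only [abs_of_nonneg (tr_nonneg f _ _)]
  exact intervalIntegral.integral_mono_on hab.le (tr_ii hm m a b) (tr_ii hm n a b)
    fun t _ => tr_mono f hmn t

lemma M_le_tr {f : ℝ → ℝ} (hm : Measurable f) (x : ℝ) : M f x ≤ ⨆ n, M (tr f n) x := by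
  simp only [M.eq_1 f, iSup_le_iff]
  intro a b hax hxb hab
  by_cases hi : IntervalIntegrable (fun t => |f t|) volume a b
  · have hl : Filter.Tendsto (fun n => ∫ t in a..b, |tr f n t|) Filter.atTop
        (nhds (∫ t in a..b, |f t|)) := by
      refine intervalIntegral.tendsto_integral_filter_of_dominated_convergence
        (fun t => |f t|) ?_ ?_ hi ?_
      · exact Filter.Eventually.of_forall fun n =>
          (tr_nice hm n).meas.abs.aestronglyMeasurable
      · refine Filter.Eventually.of_forall fun n => Filter.Eventually.of_forall fun t _ => ?_
        simpa [abs_of_nonneg (tr_nonneg f n t)] using tr_le f n t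
      · refine Filter.Eventually.of_forall fun t _ => ?_
        simpa only [abs_of_nonneg (tr_nonneg f _ _)] using tr_tendsto f t
    have hl2 := ENNReal.tendsto_ofReal (hl.const_mul (b - a)⁻¹)
    refine le_of_tendsto hl2 (Filter.Eventually.of_forall fun n => ?_)
    refine le_trans ?_ (le_iSup (fun n => M (tr f n) x) n)
    exact le_iSup_of_le a <| le_iSup_of_le b <| le_iSup_of_le hax <| le_iSup_of_le hxb <|
      le_iSup_of_le hab le_rfl
  · rw [intervalIntegral.integral_undef hi]
    simp

/-- Upper bound: `‖Mf‖_p ≤ c_p ‖f‖_p` for all `f ∈ L^p(ℝ)`, where `c_p` is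
the unique positive root of `(p-1)x^p - px^(p-1) - 1 = 0`. -/
theorem maximal_upper_bound (p cp : ℝ) (hp : 1 < p) (hcp : 0 < cp)
    (hroot : (p - 1) * cp ^ p - p * cp ^ (p - 1) - 1 = 0)
    (f : ℝ → ℝ) (hm : Measurable f)
    (hfp : (∫⁻ x, ENNReal.ofReal |f x| ^ p) < ∞) :
    (∫⁻ x, M f x ^ p) ^ (1 / p)
      ≤ ENNReal.ofReal cp * (∫⁻ x, ENNReal.ofReal |f x| ^ p) ^ (1 / p) := by
  have hp0 : 0 < p := by linarith
  rw [one_div, ENNReal.rpow_inv_le_iff hp0]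
  have h1 : ∫⁻ x, M f x ^ p ≤ ∫⁻ x, ⨆ n, M (tr f n) x ^ p := by
    refine lintegral_mono fun x => ?_
    refine (ENNReal.rpow_le_rpow (M_le_tr hm x) hp0.le).trans (le_of_eq ?_)
    exact (ENNReal.orderIsoRpow p hp0).map_iSup _
  refine h1.trans ?_
  rw [lintegral_iSup (fun n => (tr_nice hm n).M_meas.pow_const p)
    (fun m n hmn x => ENNReal.rpow_le_rpow (M_tr_mono hm hmn x) hp0.le)]
  refine iSup_le fun n => ?_
  rw [← ENNReal.rpow_inv_le_iff hp0, ← one_div]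
  refine ((tr_nice hm n).bound hp hcp hroot).trans ?_
  gcongr with x
  exact tr_le f n x
end

section
/- Corollary: for 1 < p < ∞, the operator norm of the strong maximal function N_n : L^p(ℝ^n) → L^p(ℝ^n) equals c_p^n, where c_p is the unique positive root of (p-1)x^p − p x^{p-1} − 1 = 0. In particular the upper bound ‖N_n f‖_p ≤ c_p^n ‖f‖_p holds for all f ∈ L^p(ℝ^n). -/
open MeasureTheory Set
open scoped ENNReal

/-- The strong maximal function over axis-parallel rectangles in `ℝⁿ`. -/
noncomputable def strongMax (n : ℕ) (f : (Fin n → ℝ) → ℝ)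
    (x : Fin n → ℝ) : ℝ≥0∞ :=
  ⨆ (a : Fin n → ℝ) (b : Fin n → ℝ) (_ : ∀ i, a i ≤ x i) (_ : ∀ i, x i ≤ b i)
      (_ : ∀ i, a i < b i),
    (ENNReal.ofReal (∏ i, (b i - a i)))⁻¹ *
      ∫⁻ y in univ.pi fun i => Icc (a i) (b i), ENNReal.ofReal |f y|


/-- one-interval lemma data: average over a rational interval -/
noncomputable def ratAvg (g : ℝ → ℝ≥0∞) (i : ℚ × ℚ) : ℝ≥0∞ :=
  (ENNReal.ofReal ((i.2 : ℝ) - i.1))⁻¹ * ∫⁻ y in Icc (i.1 : ℝ) i.2, g y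

noncomputable def finMax (g : ℝ → ℝ≥0∞) (s : Finset (ℚ × ℚ)) (x : ℝ) : ℝ≥0∞ :=
  s.sup fun i => (Icc (i.1 : ℝ) i.2).indicator (fun _ => ratAvg g i) x

noncomputable def ratMax (g : ℝ → ℝ≥0∞) (x : ℝ) : ℝ≥0∞ :=
  ⨆ i : ℚ × ℚ, (Icc (i.1 : ℝ) i.2).indicator (fun _ => ratAvg g i) x

def ivl (i : ℚ × ℚ) : Set ℝ := Icc (i.1 : ℝ) i.2

lemma measurableSet_ivl (i : ℚ × ℚ) : MeasurableSet (ivl i) := measurableSet_Icc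

open Classical in
noncomputable def cnt (s : Finset (ℚ × ℚ)) (x : ℝ) : ℕ := (s.filter fun i => x ∈ ivl i).card

/-- If three intervals share a point, one is contained in the union of the others. -/
lemma three_ivl (s : Finset (ℚ × ℚ)) (x : ℝ) (h : 2 < cnt s x) :
    ∃ i ∈ s, ⋃ j ∈ s.erase i, ivl j = ⋃ j ∈ s, ivl j := by
  classical
  set t := s.filter fun i => x ∈ ivl i with ht
  have hcard : 2 < t.card := by
    have : cnt s x = t.card := by unfold cnt; congr
    omega
  have hne : t.Nonempty := by rw [← Finset.card_pos]; omega
  obtain ⟨l, hl, hlmin⟩ := t.exists_min_image (fun i => i.1) hne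
  obtain ⟨r, hr, hrmax⟩ := t.exists_max_image (fun i => i.2) hne
  have : ∃ i ∈ t, i ≠ l ∧ i ≠ r := by
    by_contra hcon
    push Not at hcon
    have hsub : t ⊆ {l, r} := by
      intro i hi
      by_cases h1 : i = l
      · simp [h1]
      · simp [hcon i hi h1]
    have := Finset.card_le_card hsub
    have := Finset.card_le_two (a := l) (b := r)
    omega
  obtain ⟨i, hi, hil, hir⟩ := this
  have memt : ∀ j, j ∈ t ↔ j ∈ s ∧ x ∈ ivl j := by intro j; simp [ht]
  refine ⟨i, ((memt i).1 hi).1, ?_⟩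
  apply Subset.antisymm
  · intro y hy
    simp only [mem_iUnion, Finset.mem_erase] at hy ⊢
    obtain ⟨j, hj, hy⟩ := hy
    exact ⟨j, hj.2, hy⟩
  · intro y hy
    simp only [mem_iUnion, Finset.mem_erase] at hy ⊢
    obtain ⟨j, hj, hy⟩ := hy
    by_cases hji : j = i
    · subst hji
      have h1 := hlmin j hi
      have h2 := hrmax j hi
      obtain ⟨hls, hxl⟩ := (memt l).1 hl
      obtain ⟨hrs, hxr⟩ := (memt r).1 hr
      have h1' : (l.1 : ℝ) ≤ j.1 := by exact_mod_cast h1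
      have h2' : (j.2 : ℝ) ≤ r.2 := by exact_mod_cast h2
      simp only [ivl, mem_Icc] at hy hxl hxr
      rcases le_total y x with hyx | hyx
      · exact ⟨l, ⟨Ne.symm hil, hls⟩, by simp only [ivl, mem_Icc]; constructor <;> linarith⟩
      · exact ⟨r, ⟨Ne.symm hir, hrs⟩, by simp only [ivl, mem_Icc]; constructor <;> linarith⟩
    · exact ⟨j, ⟨hji, hj⟩, hy⟩

lemma key_ptwise (lam f : ℝ≥0∞) (hl : lam ≠ ∞) (k : ℕ) (hk : k ≤ 2) :
    (if 0 < k then lam else 0) + (if lam < f then lam else 0) + f * k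
      ≤ (if 0 < k then f else 0) + (if lam < f then f else 0) + lam * k := by
  interval_cases k
  · simp; split_ifs with h
    · exact h.le
    · exact le_rfl
  · simp; split_ifs with h
    · have := h.le
      calc lam + lam + f = lam + f + lam := by ring
        _ ≤ f + f + lam := by gcongr
    · simp [add_comm]
  · simp only [Nat.zero_lt_succ, if_true, Nat.cast_ofNat, mul_two]
    split_ifs with h
    · apply le_of_eq; ring
    · push Not at h
      calc _ = f + (lam + f) := by ring
        _ ≤ f + (lam + lam) := by gcongr
        _ = _ := by ring

lemma finite_cover (f : ℝ → ℝ≥0∞) (hf : Measurable f) (lam : ℝ≥0∞) (hl : lam ≠ ∞)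
    (s : Finset (ℚ × ℚ)) (hfin : ∀ i ∈ s, ∫⁻ y in ivl i, f y ≠ ∞)
    (hs : ∀ i ∈ s, lam * volume (ivl i) ≤ ∫⁻ y in ivl i, f y) :
    lam * volume (⋃ i ∈ s, ivl i) + lam * volume {x | lam < f x} ≤
      (∫⁻ x in ⋃ i ∈ s, ivl i, f x) + ∫⁻ x in {x | lam < f x}, f x := by
  classical
  induction hn : s.card using Nat.strong_induction_on generalizing s with
  | _ n ih =>
  by_cases h : ∃ x, 2 < cnt s x
  · obtain ⟨x, hx⟩ := h
    obtain ⟨i, his, hi⟩ := three_ivl s x hx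
    rw [← hi]
    refine ih (s.erase i).card ?_ (s.erase i) ?_ ?_ rfl
    · rw [← hn]; exact Finset.card_erase_lt_of_mem his
    · intro j hj; exact hfin j (Finset.mem_of_mem_erase hj)
    · intro j hj; exact hs j (Finset.mem_of_mem_erase hj)
  · push Not at h
    set U := ⋃ i ∈ s, ivl i with hU
    have hUm : MeasurableSet U := s.measurableSet_biUnion fun i _ => measurableSet_ivl i
    set E := {x | lam < f x} with hE
    have hEm : MeasurableSet E := measurableSet_lt measurable_const hf
    have hcU : ∀ x, 0 < cnt s x ↔ x ∈ U := by
      intro x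
      simp only [cnt, Finset.card_pos, Finset.Nonempty, Finset.mem_filter, hU, mem_iUnion]
      constructor
      · rintro ⟨i, h1, h2⟩; exact ⟨i, h1, h2⟩
      · rintro ⟨i, h1, h2⟩; exact ⟨i, h1, h2⟩
    have hcsum : ∀ (g : ℝ → ℝ≥0∞) x, g x * (cnt s x : ℝ≥0∞) = ∑ i ∈ s, (ivl i).indicator g x := by
      intro g x
      simp only [indicator_apply, cnt]
      rw [← Finset.sum_filter, Finset.sum_const, nsmul_eq_mul, mul_comm]
    have hcount : ∀ g : ℝ → ℝ≥0∞, Measurable g →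
        ∫⁻ x, g x * (cnt s x : ℝ≥0∞) = ∑ i ∈ s, ∫⁻ y in ivl i, g y := by
      intro g hg
      simp_rw [hcsum g]
      rw [lintegral_finsetSum _ fun i _ => hg.indicator (measurableSet_ivl i)]
      exact Finset.sum_congr rfl fun i _ => lintegral_indicator (measurableSet_ivl i) _
    have hmeas : ∀ g : ℝ → ℝ≥0∞, Measurable g → Measurable fun x => g x * (cnt s x : ℝ≥0∞) := by
      intro g hg
      simp_rw [hcsum g]
      exact Finset.measurable_sum _ fun i _ => hg.indicator (measurableSet_ivl i)
    have key : ∀ x, U.indicator (fun _ => lam) x + E.indicator (fun _ => lam) x + f x * (cnt s x : ℝ≥0∞)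
        ≤ U.indicator f x + E.indicator f x + lam * (cnt s x : ℝ≥0∞) := by
      intro x
      have := key_ptwise lam (f x) hl (cnt s x) (h x)
      simp only [indicator_apply, ← hcU, hE, mem_ofPred_eq]
      convert this
    have := lintegral_mono (μ := volume) key
    rw [lintegral_add_right _ (hmeas f hf), lintegral_add_right _ (hmeas (fun _ => lam) measurable_const),
      lintegral_add_left (measurable_const.indicator hUm), lintegral_add_left (hf.indicator hUm),
      lintegral_indicator hUm, lintegral_indicator hEm, lintegral_indicator hUm,
      lintegral_indicator hEm, setLIntegral_const, setLIntegral_const, hcount f hf,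
      hcount (fun _ => lam) measurable_const] at this
    have h2 : ∑ i ∈ s, ∫⁻ _ in ivl i, lam ≤ ∑ i ∈ s, ∫⁻ y in ivl i, f y := by
      refine Finset.sum_le_sum fun i hi => ?_
      rw [setLIntegral_const]; exact hs i hi
    have h3 : ∑ i ∈ s, ∫⁻ y in ivl i, f y ≠ ∞ := by
      rw [ENNReal.sum_ne_top]; exact hfin
    have h4 := this.trans (add_le_add_right h2 _)
    exact (ENNReal.add_le_add_iff_right h3).1 h4

lemma layer_fin (r : ℝ) (hr : 0 < r) : ∀ u : ℝ, 0 ≤ u → ∫⁻ l in Ioo (0:ℝ) u, ENNReal.ofReal (r * l ^ (r - 1))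
    = (ENNReal.ofReal u) ^ r := by
  intro u hu
  have hii : IntervalIntegrable (fun l : ℝ => r * l ^ (r-1)) volume 0 u :=
    (intervalIntegral.intervalIntegrable_rpow' (by linarith)).const_mul r
  rw [restrict_Ioo_eq_restrict_Ioc, ← ofReal_integral_eq_lintegral_ofReal]
  · rw [← intervalIntegral.integral_of_le hu, intervalIntegral.integral_const_mul,
      integral_rpow (Or.inl (by linarith)), ENNReal.ofReal_rpow_of_nonneg hu hr.le]
    congr 1
    simp [Real.zero_rpow hr.ne']
    field_simp
  · exact (intervalIntegrable_iff_integrableOn_Ioc_of_le hu).1 hii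
  · refine (ae_restrict_iff' measurableSet_Ioc).2 (Filter.Eventually.of_forall fun x hx => ?_)
    have := Real.rpow_nonneg hx.1.le (r-1)
    simp only [Pi.zero_apply]; positivity

lemma layer_one (r : ℝ) (hr : 0 < r) (t : ℝ≥0∞) :
    ∫⁻ l in Ioi (0:ℝ), ENNReal.ofReal (r * l ^ (r - 1)) * (if ENNReal.ofReal l < t then 1 else 0)
      = t ^ r := by
  have fin := layer_fin r hr
  by_cases ht : t = ∞
  · subst ht
    simp only [ENNReal.ofReal_lt_top, if_true, mul_one, ENNReal.top_rpow_of_pos hr]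
    refine ENNReal.eq_top_of_forall_nnreal_le fun v => ?_
    have h1 := fin ((v:ℝ) ^ (1/r)) (by positivity)
    have h2 : (ENNReal.ofReal ((v:ℝ) ^ (1/r))) ^ r = v := by
      rw [ENNReal.ofReal_rpow_of_nonneg (by positivity) hr.le, ← Real.rpow_mul (by positivity)]
      simp [hr.ne']
    rw [← h2, ← h1]
    exact lintegral_mono_set Ioo_subset_Ioi_self
  · lift t to NNReal using ht
    have h1 := fin t t.2
    rw [ENNReal.ofReal_coe_nnreal] at h1
    rw [← h1, ← lintegral_indicator measurableSet_Ioi, ← lintegral_indicator measurableSet_Ioo]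
    congr 1
    ext l
    simp only [indicator_apply, mem_Ioi, mem_Ioo]
    by_cases hl : 0 < l
    · have : ENNReal.ofReal l < (t:ℝ≥0∞) ↔ l < t := by
        rw [← ENNReal.ofReal_coe_nnreal, ENNReal.ofReal_lt_ofReal_iff_of_nonneg hl.le]
      simp [hl, this]
    · simp [hl]

/-- Layer cake with weight. -/
lemma layer_cake (r : ℝ) (hr : 0 < r) (w G : ℝ → ℝ≥0∞) (hw : Measurable w) (hG : Measurable G) :
    ∫⁻ x, w x * G x ^ r = ∫⁻ l in Ioi (0:ℝ), ENNReal.ofReal (r * l ^ (r - 1)) *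
      ∫⁻ x in {x | ENNReal.ofReal l < G x}, w x := by
  have hm : Measurable fun q : ℝ × ℝ => (if ENNReal.ofReal q.2 < G q.1 then (1:ℝ≥0∞) else 0) := by
    refine Measurable.ite (measurableSet_lt ?_ ?_) measurable_const measurable_const
    · exact ENNReal.measurable_ofReal.comp measurable_snd
    · exact hG.comp measurable_fst
  have hpow : Measurable fun l : ℝ => ENNReal.ofReal (r * l ^ (r - 1)) := by fun_prop
  calc ∫⁻ x, w x * G x ^ r = ∫⁻ x, ∫⁻ l in Ioi (0:ℝ), w x * (ENNReal.ofReal (r * l ^ (r - 1)) *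
        (if ENNReal.ofReal l < G x then 1 else 0)) := by
        refine lintegral_congr fun x => ?_
        rw [lintegral_const_mul, layer_one r hr]
        exact hpow.mul (hm.comp (measurable_const.prodMk measurable_id : Measurable fun l : ℝ => (x, l)))
    _ = ∫⁻ l in Ioi (0:ℝ), ∫⁻ x, w x * (ENNReal.ofReal (r * l ^ (r - 1)) *
        (if ENNReal.ofReal l < G x then 1 else 0)) := by
        refine lintegral_lintegral_swap ?_
        refine Measurable.aemeasurable ?_
        exact (hw.comp measurable_fst).mul ((hpow.comp measurable_snd).mul hm)
    _ = _ := by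
        refine lintegral_congr fun l => ?_
        have hS : MeasurableSet {x | ENNReal.ofReal l < G x} := measurableSet_lt measurable_const hG
        rw [← lintegral_indicator hS, ← lintegral_const_mul _ (hw.indicator hS)]
        refine lintegral_congr fun x => ?_
        simp only [indicator_apply, mem_ofPred_eq]
        split_ifs
        · ring
        · simp

lemma real_step (p cp a b : ℝ) (hp : 1 < p) (hcp : 0 < cp)
    (hroot : (p - 1) * cp ^ p - p * cp ^ (p - 1) - 1 = 0) (ha : 0 ≤ a) (hb : 0 ≤ b)
    (h : (p - 1) * a ^ p ≤ p * (b * a ^ (p-1)) + b ^ p) : a ≤ cp * b := by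
  by_contra hcon
  push Not at hcon
  have hp0 : 0 < p := by linarith
  have split : ∀ t : ℝ, 0 < t → t ^ p = t ^ (p-1) * t := by
    intro t ht
    rw [← Real.rpow_add_one ht.ne']; congr 1; ring
  rcases hb.eq_or_lt with rfl | hb
  · have ha' : 0 < a := by simpa using hcon
    rw [Real.zero_rpow hp0.ne'] at h
    have := Real.rpow_pos_of_pos ha' p
    nlinarith
  · have ha' : 0 < a := lt_of_le_of_lt (by positivity) hcon
    obtain ⟨t, ht, rfl⟩ : ∃ t, cp < t ∧ a = t * b := ⟨a / b, by rwa [lt_div_iff₀ hb], by field_simp⟩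
    have ht0 : 0 < t := hcp.trans ht
    rw [Real.mul_rpow ht0.le hb.le, Real.mul_rpow ht0.le hb.le, split t ht0, split b hb] at h
    rw [split cp hcp] at hroot
    have hB := Real.rpow_pos_of_pos hb (p-1)
    have hlt : cp ^ (p-1) < t ^ (p-1) := Real.rpow_lt_rpow hcp.le ht (by linarith)
    have hc1 := Real.rpow_pos_of_pos hcp (p-1)
    set X := cp ^ (p-1)
    set T := t ^ (p-1)
    have hpos : 0 < (p-1) * cp - p := by
      have : X * ((p-1) * cp - p) = 1 := by linarith
      by_contra h'
      push Not at h'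
      nlinarith
    have h3 : ((p-1)*(T*t) - p * T - 1) * (b ^ (p-1) * b) ≤ 0 := by linarith
    have h4 : (p-1)*(T*t) - p * T - 1 ≤ 0 := by
      by_contra h'
      push Not at h'
      have : 0 < b ^ (p-1) * b := by positivity
      nlinarith
    have h5 : (p-1) * cp - p < (p-1) * t - p := by nlinarith
    have : X * ((p-1) * cp - p) < T * ((p-1) * t - p) := by
      apply mul_lt_mul'' hlt h5 hc1.le hpos.le
    linarith

lemma loc_fin (f : ℝ → ℝ≥0∞) (p : ℝ) (hp : 1 < p) (hf : Measurable f)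
    (hB : ∫⁻ x, f x ^ p ≠ ∞) (i : ℚ × ℚ) : ∫⁻ y in ivl i, f y ≠ ∞ := by
  have h1 : ∀ x, f x ≤ 1 + f x ^ p := by
    intro x
    rcases le_total (f x) 1 with h | h
    · exact h.trans le_self_add
    · calc f x = f x ^ (1:ℝ) := by simp
        _ ≤ f x ^ p := ENNReal.rpow_le_rpow_of_exponent_le h hp.le
        _ ≤ _ := le_add_self
  refine ne_top_of_le_ne_top ?_ (lintegral_mono (μ := volume.restrict (ivl i)) h1)
  rw [lintegral_add_left measurable_const, lintegral_const]
  refine ENNReal.add_ne_top.2 ⟨?_, ?_⟩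
  · simp [ivl]
  · exact ne_top_of_le_ne_top hB (setLIntegral_le_lintegral _ _)

lemma measurable_finMax (g : ℝ → ℝ≥0∞) (s : Finset (ℚ × ℚ)) : Measurable (finMax g s) := by
  unfold finMax
  simp_rw [Finset.sup_eq_iSup]
  exact Measurable.iSup fun i => Measurable.iSup fun _ =>
    measurable_const.indicator measurableSet_Icc

lemma finMax_distrib (f : ℝ → ℝ≥0∞) (hf : Measurable f) (s : Finset (ℚ × ℚ))
    (hfin : ∀ i, ∫⁻ y in ivl i, f y ≠ ∞) (lam : ℝ≥0∞) (hl : lam ≠ ∞) :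
    lam * volume {x | lam < finMax f s x} + lam * volume {x | lam < f x} ≤
      (∫⁻ x in {x | lam < finMax f s x}, f x) + ∫⁻ x in {x | lam < f x}, f x := by
  classical
  have hU : {x | lam < finMax f s x} = ⋃ i ∈ s.filter (fun i => lam < ratAvg f i), ivl i := by
    ext x
    simp only [finMax, mem_ofPred_eq, Finset.lt_sup_iff, mem_iUnion, Finset.mem_filter, exists_prop,
      indicator_apply]
    constructor
    · rintro ⟨i, hi, h⟩
      by_cases hx : x ∈ Icc (i.1:ℝ) i.2
      · rw [if_pos hx] at h; exact ⟨i, ⟨hi, h⟩, hx⟩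
      · rw [if_neg hx] at h; simp at h
    · rintro ⟨i, ⟨hi, h⟩, hx⟩
      refine ⟨i, hi, ?_⟩
      rw [if_pos (show x ∈ Icc (i.1:ℝ) i.2 from hx)]; exact h
  rw [hU]
  refine finite_cover f hf lam hl _ (fun i _ => hfin i) ?_
  intro i hi
  have h := (Finset.mem_filter.1 hi).2
  unfold ratAvg at h
  rw [ivl, Real.volume_Icc]
  by_cases h0 : ENNReal.ofReal ((i.2:ℝ) - i.1) = 0
  · simp [h0]
  · rw [mul_comm, ← div_eq_mul_inv] at h
    have := h.le
    rwa [ENNReal.le_div_iff_mul_le (Or.inl h0) (Or.inl ENNReal.ofReal_ne_top)] at this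

lemma antitone_layer (G w : ℝ → ℝ≥0∞) :
    Measurable fun l : ℝ => ∫⁻ x in {x | ENNReal.ofReal l < G x}, w x := by
  apply Antitone.measurable
  intro a b hab
  exact lintegral_mono_set fun x hx => lt_of_le_of_lt (ENNReal.ofReal_le_ofReal hab) hx

lemma finMax_energy (f : ℝ → ℝ≥0∞) (hf : Measurable f) (p : ℝ) (hp : 1 < p) (s : Finset (ℚ × ℚ))
    (hfin : ∀ i, ∫⁻ y in ivl i, f y ≠ ∞) :
    ENNReal.ofReal (p - 1) * ((∫⁻ x, finMax f s x ^ p) + ∫⁻ x, f x ^ p) ≤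
      ENNReal.ofReal p * ((∫⁻ x, f x * finMax f s x ^ (p - 1)) + ∫⁻ x, f x ^ p) := by
  have hp0 : 0 < p := by linarith
  have hp1 : 0 < p - 1 := by linarith
  have hG := measurable_finMax f s
  have hff : ∫⁻ x, f x ^ p = ∫⁻ x, f x * f x ^ (p-1) := by
    refine lintegral_congr fun x => ?_
    conv_rhs => rw [← ENNReal.rpow_one (f x), ← ENNReal.rpow_mul, one_mul,
      ← ENNReal.rpow_add_of_nonneg _ _ zero_le_one hp1.le]
    congr 1; ring
  have e1 : ∀ G : ℝ → ℝ≥0∞, Measurable G → ∫⁻ x, G x ^ p =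
      ∫⁻ l in Ioi (0:ℝ), ENNReal.ofReal (p * l ^ (p - 1)) * volume {x | ENNReal.ofReal l < G x} := by
    intro G hG
    have := layer_cake p hp0 (fun _ => 1) G measurable_const hG
    simpa using this
  have mvol : ∀ G : ℝ → ℝ≥0∞, Measurable fun l : ℝ => volume {x | ENNReal.ofReal l < G x} := by
    intro G
    simpa using antitone_layer G (fun _ => 1)
  have hpow : ∀ r : ℝ, Measurable fun l : ℝ => ENNReal.ofReal (r * l ^ (r - 1)) := by
    intro r; fun_prop
  have m1 : ∀ G : ℝ → ℝ≥0∞, Measurable fun l : ℝ =>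
      ENNReal.ofReal (p * l ^ (p - 1)) * volume {x | ENNReal.ofReal l < G x} :=
    fun G => (hpow p).mul (mvol G)
  have m2 : ∀ G : ℝ → ℝ≥0∞, Measurable fun l : ℝ =>
      ENNReal.ofReal ((p - 1) * l ^ (p - 1 - 1)) * ∫⁻ x in {x | ENNReal.ofReal l < G x}, f x :=
    fun G => (hpow (p-1)).mul (antitone_layer G f)
  nth_rewrite 2 [hff]
  rw [e1 _ hG, e1 _ hf, layer_cake (p-1) hp1 f _ hf hG, layer_cake (p-1) hp1 f f hf hf,
    ← lintegral_add_left (m1 _), ← lintegral_add_left (m2 _),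
    ← lintegral_const_mul _ ((m1 _).fun_add (m1 _)), ← lintegral_const_mul _ ((m2 _).fun_add (m2 _))]
  refine setLIntegral_mono' measurableSet_Ioi fun l hl => ?_
  have hl : 0 < l := hl
  have hk := finMax_distrib f hf s hfin (ENNReal.ofReal l) ENNReal.ofReal_ne_top
  have c1 : ENNReal.ofReal (p-1) * ENNReal.ofReal (p * l ^ (p-1)) =
      ENNReal.ofReal ((p-1) * p * l ^ (p-1-1)) * ENNReal.ofReal l := by
    have := Real.rpow_nonneg hl.le (p-1-1)
    rw [← ENNReal.ofReal_mul hp1.le, ← ENNReal.ofReal_mul (by positivity)]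
    congr 1
    rw [mul_assoc _ _ l, ← Real.rpow_add_one hl.ne']
    ring_nf
  have c2 : ENNReal.ofReal p * ENNReal.ofReal ((p-1) * l ^ (p-1-1)) =
      ENNReal.ofReal ((p-1) * p * l ^ (p-1-1)) := by
    rw [← ENNReal.ofReal_mul hp0.le]
    congr 1; ring
  rw [← mul_add, ← mul_add, ← mul_assoc, ← mul_assoc, c1, c2, mul_assoc, mul_add]
  gcongr

lemma finMax_fin (f : ℝ → ℝ≥0∞) (p : ℝ) (hp : 1 < p) (s : Finset (ℚ × ℚ))
    (hfin : ∀ i, ∫⁻ y in ivl i, f y ≠ ∞) : ∫⁻ x, finMax f s x ^ p ≠ ∞ := by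
  have hp0 : 0 < p := by linarith
  have havg : ∀ i, ratAvg f i ≠ ∞ := by
    intro i
    unfold ratAvg
    by_cases h0 : (i.2:ℝ) ≤ i.1
    · have : volume (Icc (i.1:ℝ) i.2) = 0 := by simp [h0]
      rw [setLIntegral_measure_zero _ _ this]; simp
    · refine ENNReal.mul_ne_top ?_ (hfin i)
      push Not at h0
      rw [Ne, ENNReal.inv_eq_top, ENNReal.ofReal_eq_zero]
      linarith
  have hb : ∀ x, finMax f s x ^ p ≤ ∑ i ∈ s, (ivl i).indicator (fun _ => ratAvg f i ^ p) x := by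
    intro x
    have : finMax f s x ^ p ≤ s.sup fun i => (ivl i).indicator (fun _ => ratAvg f i ^ p) x := by
      have h0 : (fun t : ℝ≥0∞ => t ^ p) (finMax f s x) = s.sup ((fun t : ℝ≥0∞ => t ^ p) ∘
          fun i => (Icc (i.1 : ℝ) i.2).indicator (fun _ => ratAvg f i) x) := by
        unfold finMax
        refine Finset.apply_sup_eq_sup_comp_of_linearOrder _ (ENNReal.monotone_rpow_of_nonneg hp0.le) ?_
        simp [hp0]
      simp only at h0
      rw [h0]
      refine le_of_eq (Finset.sup_congr rfl fun i _ => ?_)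
      simp only [Function.comp, indicator_apply, ivl]
      split_ifs <;> simp [hp0]
    refine this.trans (Finset.sup_le fun i hi => ?_)
    exact Finset.single_le_sum (f := fun i => (ivl i).indicator (fun _ => ratAvg f i ^ p) x)
      (fun _ _ => zero_le) hi
  refine ne_top_of_le_ne_top ?_ (lintegral_mono hb)
  rw [lintegral_finsetSum _ fun i _ => measurable_const.indicator (measurableSet_ivl i)]
  refine ENNReal.sum_ne_top.2 fun i _ => ?_
  rw [lintegral_indicator (measurableSet_ivl i), setLIntegral_const]
  refine ENNReal.mul_ne_top (ENNReal.rpow_ne_top_of_nonneg hp0.le (havg i)) ?_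
  simp [ivl]

lemma finMax_bound (f : ℝ → ℝ≥0∞) (hf : Measurable f) (p cp : ℝ) (hp : 1 < p) (hcp : 0 < cp)
    (hroot : (p - 1) * cp ^ p - p * cp ^ (p - 1) - 1 = 0) (s : Finset (ℚ × ℚ))
    (hB : ∫⁻ x, f x ^ p ≠ ∞) :
    ∫⁻ x, finMax f s x ^ p ≤ ENNReal.ofReal (cp ^ p) * ∫⁻ x, f x ^ p := by
  have hp0 : 0 < p := by linarith
  have hp1 : 0 < p - 1 := by linarith
  have hfin := fun i => loc_fin f p hp hf hB i
  have hA := finMax_fin f p hp s hfin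
  have hen := finMax_energy f hf p hp s hfin
  have hG := measurable_finMax f s
  have hconj : p.HolderConjugate (p / (p-1)) := Real.HolderConjugate.conjExponent hp
  have hold := ENNReal.lintegral_mul_le_Lp_mul_Lq volume hconj hf.aemeasurable
    (hG.pow_const (p-1)).aemeasurable
  simp only [Pi.mul_apply, ← ENNReal.rpow_mul] at hold
  have e1 : (p-1) * (p / (p-1)) = p := by field_simp
  have e2 : 1 / (p / (p-1)) = (p-1)/p := by field_simp
  rw [e1, e2] at hold
  set A := ∫⁻ x, finMax f s x ^ p with hAdef
  set B := ∫⁻ x, f x ^ p with hBdef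
  obtain ⟨a, ha0, haA⟩ : ∃ a : ℝ, 0 ≤ a ∧ A = ENNReal.ofReal (a ^ p) := by
    refine ⟨A.toReal ^ (1/p), by positivity, ?_⟩
    rw [← Real.rpow_mul (by positivity)]
    simp [hp0.ne', hA]
  obtain ⟨b, hb0, hbB⟩ : ∃ a : ℝ, 0 ≤ a ∧ B = ENNReal.ofReal (a ^ p) := by
    refine ⟨B.toReal ^ (1/p), by positivity, ?_⟩
    rw [← Real.rpow_mul (by positivity)]
    simp [hp0.ne', hB]
  have h1 := hen.trans (mul_le_mul_right (add_le_add_left hold _) _)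
  rw [haA, hbB, ENNReal.ofReal_rpow_of_nonneg (by positivity) (by positivity),
    ENNReal.ofReal_rpow_of_nonneg (by positivity) (by positivity), ← Real.rpow_mul hb0,
    ← Real.rpow_mul ha0, ← ENNReal.ofReal_add (by positivity) (by positivity),
    ← ENNReal.ofReal_mul hp1.le, ← ENNReal.ofReal_mul (by positivity),
    ← ENNReal.ofReal_add (by positivity) (by positivity), ← ENNReal.ofReal_mul hp0.le,
    ENNReal.ofReal_le_ofReal_iff (by positivity)] at h1
  have e3 : p * (1/p) = 1 := by field_simp
  have e4 : p * ((p-1)/p) = p - 1 := by field_simp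
  rw [e3, e4, Real.rpow_one] at h1
  have := real_step p cp a b hp hcp hroot ha0 hb0 (by linarith)
  rw [haA, hbB, ← ENNReal.ofReal_mul (by positivity), ← Real.mul_rpow hcp.le hb0]
  exact ENNReal.ofReal_le_ofReal (Real.rpow_le_rpow ha0 this hp0.le)

lemma ratMax_bound (f : ℝ → ℝ≥0∞) (hf : Measurable f) (p cp : ℝ) (hp : 1 < p) (hcp : 0 < cp)
    (hroot : (p - 1) * cp ^ p - p * cp ^ (p - 1) - 1 = 0) :
    ∫⁻ x, ratMax f x ^ p ≤ ENNReal.ofReal (cp ^ p) * ∫⁻ x, f x ^ p := by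
  have hp0 : 0 < p := by linarith
  by_cases hB : ∫⁻ x, f x ^ p = ∞
  · rw [hB, ENNReal.mul_top]
    · exact le_top
    · have := Real.rpow_pos_of_pos hcp p
      simpa using this
  have h1 : ∀ x, ratMax f x ^ p = ⨆ s : Finset (ℚ × ℚ), finMax f s x ^ p := by
    intro x
    have : ratMax f x = ⨆ s : Finset (ℚ × ℚ), finMax f s x := by
      unfold ratMax finMax
      rw [iSup_eq_iSup_finset]
      simp_rw [Finset.sup_eq_iSup]
    rw [this]
    exact (ENNReal.orderIsoRpow p hp0).map_iSup _
  simp_rw [h1]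
  rw [lintegral_iSup_directed]
  · exact iSup_le fun s => finMax_bound f hf p cp hp hcp hroot s hB
  · exact fun s => ((measurable_finMax f s).pow_const p).aemeasurable
  · apply Monotone.directed_le
    intro s t hst x
    exact ENNReal.rpow_le_rpow (Finset.sup_mono hst) hp0.le

lemma measurable_cons (n : ℕ) :
    Measurable fun q : ℝ × (Fin n → ℝ) => (Fin.cons q.1 q.2 : Fin (n+1) → ℝ) := by
  refine measurable_pi_iff.2 fun i => ?_
  refine Fin.cases ?_ (fun j => ?_) i
  · simpa using measurable_fst
  · simp only [Fin.cons_succ]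
    exact (measurable_pi_apply j).comp measurable_snd

lemma measurable_cons_right {n : ℕ} {F : (Fin (n+1) → ℝ) → ℝ≥0∞} (hF : Measurable F) (t : ℝ) :
    Measurable fun y : Fin n → ℝ => F (Fin.cons t y) :=
  (hF.comp (measurable_cons n)).comp (measurable_const.prodMk measurable_id)

lemma fubini_cons (n : ℕ) (F : (Fin (n+1) → ℝ) → ℝ≥0∞) (hF : Measurable F) :
    ∫⁻ x, F x = ∫⁻ t : ℝ, ∫⁻ y : Fin n → ℝ, F (Fin.cons t y) := by
  have h := (volume_preserving_piFinSuccAbove (fun _ : Fin (n+1) => ℝ) 0).symm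
  have h2 := h.lintegral_comp hF
  rw [← h2]
  have h3 : ∀ q : ℝ × (Fin n → ℝ),
      (MeasurableEquiv.piFinSuccAbove (fun _ : Fin (n+1) => ℝ) 0).symm q = Fin.cons q.1 q.2 := by
    intro q
    simp [MeasurableEquiv.piFinSuccAbove_symm_apply, Fin.insertNthEquiv]
  have h4 : ∫⁻ q : ℝ × (Fin n → ℝ), F (Fin.cons q.1 q.2) =
      ∫⁻ t : ℝ, ∫⁻ y : Fin n → ℝ, F (Fin.cons t y) :=
    lintegral_prod (μ := (volume : Measure ℝ)) (ν := (volume : Measure (Fin n → ℝ)))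
      (fun q : ℝ × (Fin n → ℝ) => F (Fin.cons q.1 q.2)) (hF.comp (measurable_cons n)).aemeasurable
  rw [← h4]
  exact lintegral_congr fun q => by rw [← h3 q]

lemma fubini_cons_set (n : ℕ) (F : (Fin (n+1) → ℝ) → ℝ≥0∞) (hF : Measurable F)
    (S : Fin (n+1) → Set ℝ) (hS : ∀ i, MeasurableSet (S i)) :
    ∫⁻ x in univ.pi S, F x =
      ∫⁻ t in S 0, ∫⁻ y in univ.pi (fun i : Fin n => S i.succ), F (Fin.cons t y) := by
  classical
  have hm : MeasurableSet (univ.pi S) := MeasurableSet.univ_pi hS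
  have hm' : MeasurableSet (univ.pi (fun i : Fin n => S i.succ)) :=
    MeasurableSet.univ_pi fun i => hS i.succ
  rw [← lintegral_indicator hm, fubini_cons n _ (hF.indicator hm), ← lintegral_indicator (hS 0)]
  refine lintegral_congr fun t => ?_
  have hmem : ∀ y : Fin n → ℝ, (Fin.cons t y : Fin (n+1) → ℝ) ∈ univ.pi S ↔
      t ∈ S 0 ∧ y ∈ univ.pi (fun i : Fin n => S i.succ) := by
    intro y
    simp [Fin.forall_fin_succ]
  by_cases ht : t ∈ S 0
  · rw [indicator_of_mem ht, ← lintegral_indicator hm']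
    refine lintegral_congr fun y => ?_
    simp only [indicator_apply, hmem, ht, true_and]
  · rw [indicator_of_notMem ht]
    simp [indicator_apply, hmem, ht]

/-- The box with rational corners. -/
def box (n : ℕ) (q : (Fin n → ℚ) × (Fin n → ℚ)) : Set (Fin n → ℝ) :=
  univ.pi fun i => Icc (q.1 i : ℝ) (q.2 i)

lemma measurableSet_box (n : ℕ) (q : (Fin n → ℚ) × (Fin n → ℚ)) : MeasurableSet (box n q) :=
  MeasurableSet.univ_pi fun _ => measurableSet_Icc

noncomputable def boxAvg (n : ℕ) (F : (Fin n → ℝ) → ℝ≥0∞) (q : (Fin n → ℚ) × (Fin n → ℚ)) : ℝ≥0∞ :=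
  (∏ i, (ENNReal.ofReal ((q.2 i : ℝ) - q.1 i))⁻¹) * ∫⁻ y in box n q, F y

noncomputable def boxMax (n : ℕ) (F : (Fin n → ℝ) → ℝ≥0∞) (x : Fin n → ℝ) : ℝ≥0∞ :=
  ⨆ q : (Fin n → ℚ) × (Fin n → ℚ), (box n q).indicator (fun _ => boxAvg n F q) x

lemma measurable_boxMax (n : ℕ) (F : (Fin n → ℝ) → ℝ≥0∞) : Measurable (boxMax n F) :=
  Measurable.iSup fun q => measurable_const.indicator (measurableSet_box n q)

lemma measurable_boxMax_joint (n : ℕ) (F : (Fin (n+1) → ℝ) → ℝ≥0∞) (hF : Measurable F) :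
    Measurable fun q : ℝ × (Fin n → ℝ) => boxMax n (fun y => F (Fin.cons q.1 y)) q.2 := by
  unfold boxMax
  refine Measurable.iSup fun q => ?_
  have h1 : Measurable fun t : ℝ => boxAvg n (fun y => F (Fin.cons t y)) q := by
    unfold boxAvg
    refine Measurable.const_mul ?_ _
    exact (hF.comp (measurable_cons n)).lintegral_prod_right'
  have h2 : MeasurableSet ((Prod.snd : ℝ × (Fin n → ℝ) → (Fin n → ℝ)) ⁻¹' (box n q)) :=
    measurable_snd (measurableSet_box n q)
  exact (h1.comp measurable_fst).indicator h2

lemma boxMax_succ_le (n : ℕ) (F : (Fin (n+1) → ℝ) → ℝ≥0∞) (hF : Measurable F) (t : ℝ)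
    (y : Fin n → ℝ) :
    boxMax (n+1) F (Fin.cons t y) ≤ ratMax (fun u => boxMax n (fun z => F (Fin.cons u z)) y) t := by
  refine iSup_le fun q => ?_
  by_cases hx : (Fin.cons t y : Fin (n+1) → ℝ) ∈ box (n+1) q
  swap
  · rw [indicator_of_notMem hx]; exact zero_le
  rw [indicator_of_mem hx]
  have hx0 : t ∈ Icc (q.1 0 : ℝ) (q.2 0) := by
    have := hx 0 (mem_univ _); simpa using this
  let q' : (Fin n → ℚ) × (Fin n → ℚ) := (fun i => q.1 i.succ, fun i => q.2 i.succ)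
  have hy : y ∈ box n q' := by
    intro i _
    have := hx i.succ (mem_univ _); simpa using this
  refine le_trans ?_ (le_iSup _ ((q.1 0, q.2 0) : ℚ × ℚ))
  rw [indicator_of_mem (by exact hx0)]
  unfold boxAvg ratAvg
  rw [Fin.prod_univ_succ, mul_assoc]
  refine mul_le_mul_right ?_ _
  unfold box
  rw [fubini_cons_set n F hF _ (fun _ => measurableSet_Icc), ← lintegral_const_mul]
  · refine lintegral_mono fun u => ?_
    refine le_trans ?_ (le_iSup _ q')
    rw [indicator_of_mem hy]
    exact le_rfl
  · exact (hF.comp (measurable_cons n)).lintegral_prod_right'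

lemma boxMax_bound (p cp : ℝ) (hp : 1 < p) (hcp : 0 < cp)
    (hroot : (p - 1) * cp ^ p - p * cp ^ (p - 1) - 1 = 0) (n : ℕ) :
    ∀ (F : (Fin n → ℝ) → ℝ≥0∞), Measurable F →
    ∫⁻ x, boxMax n F x ^ p ≤ ENNReal.ofReal (cp ^ p) ^ n * ∫⁻ x, F x ^ p := by
  have hp0 : 0 < p := by linarith
  induction n with
  | zero =>
    intro F hF
    have h1 : ∀ x, boxMax 0 F x ≤ F x := by
      intro x
      refine iSup_le fun q => ?_
      have hb : box 0 q = univ := by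
        ext z; simp [box]
      rw [hb, indicator_univ]
      unfold boxAvg
      rw [hb]
      have : ∀ z, F z = F x := fun z => by rw [Subsingleton.elim z x]
      simp only [this, lintegral_const]
      have hv : volume (univ : Set (Fin 0 → ℝ)) = 1 := by
        rw [← pi_univ univ, volume_pi_pi]; simp
      simp [hv]
    simp only [pow_zero, one_mul]
    exact lintegral_mono fun x => ENNReal.rpow_le_rpow (h1 x) hp0.le
  | succ n ih =>
    intro F hF
    set H : ℝ × (Fin n → ℝ) → ℝ≥0∞ := fun q => boxMax n (fun y => F (Fin.cons q.1 y)) q.2 with hH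
    have hHm : Measurable H := measurable_boxMax_joint n F hF
    have hsw : ∫⁻ x, boxMax (n+1) F x ^ p =
        ∫⁻ y : Fin n → ℝ, ∫⁻ t : ℝ, boxMax (n+1) F (Fin.cons t y) ^ p := by
      rw [fubini_cons n _ ((measurable_boxMax (n+1) F).pow_const p)]
      refine lintegral_lintegral_swap ?_
      exact (((measurable_boxMax (n+1) F).pow_const p).comp (measurable_cons n)).aemeasurable
    calc ∫⁻ x, boxMax (n+1) F x ^ p
        = ∫⁻ y : Fin n → ℝ, ∫⁻ t : ℝ, boxMax (n+1) F (Fin.cons t y) ^ p := hsw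
      _ ≤ ∫⁻ y : Fin n → ℝ, ∫⁻ t : ℝ, ratMax (fun u => H (u, y)) t ^ p := by
          refine lintegral_mono fun y => lintegral_mono fun t => ?_
          exact ENNReal.rpow_le_rpow (boxMax_succ_le n F hF t y) hp0.le
      _ ≤ ∫⁻ y : Fin n → ℝ, ENNReal.ofReal (cp ^ p) * ∫⁻ t : ℝ, H (t, y) ^ p := by
          refine lintegral_mono fun y => ?_
          exact ratMax_bound (fun u => H (u, y))
            (hHm.comp (measurable_id.prodMk measurable_const)) p cp hp hcp hroot
      _ = ENNReal.ofReal (cp ^ p) * ∫⁻ y : Fin n → ℝ, ∫⁻ t : ℝ, H (t, y) ^ p := by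
          rw [lintegral_const_mul]
          exact (hHm.pow_const p).lintegral_prod_left'
      _ = ENNReal.ofReal (cp ^ p) * ∫⁻ t : ℝ, ∫⁻ y : Fin n → ℝ, H (t, y) ^ p := by
          congr 1
          refine lintegral_lintegral_swap ?_
          exact ((hHm.pow_const p).comp measurable_swap).aemeasurable
      _ ≤ ENNReal.ofReal (cp ^ p) * ∫⁻ t : ℝ, ENNReal.ofReal (cp ^ p) ^ n *
            ∫⁻ y : Fin n → ℝ, F (Fin.cons t y) ^ p := by
          gcongr with t
          exact ih (fun y => F (Fin.cons t y)) (measurable_cons_right hF t)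
      _ = ENNReal.ofReal (cp ^ p) ^ (n+1) * ∫⁻ x, F x ^ p := by
          rw [lintegral_const_mul, fubini_cons n _ (hF.pow_const p), pow_succ, ← mul_assoc,
            mul_comm (ENNReal.ofReal (cp ^ p))]
          exact ((hF.pow_const p).comp (measurable_cons n)).lintegral_prod_right'

lemma strongMax_le_boxMax (n : ℕ) (f : (Fin n → ℝ) → ℝ) (x : Fin n → ℝ) :
    strongMax n f x ≤ boxMax n (fun y => ENNReal.ofReal |f y|) x := by
  unfold strongMax
  refine iSup_le fun a => iSup_le fun b => iSup_le fun hax => iSup_le fun hxb =>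
    iSup_le fun hab => ?_
  choose u hu1 hu2 hu3 using fun i => Real.exists_seq_rat_strictMono_tendsto (a i)
  choose v hv1 hv2 hv3 using fun i => Real.exists_seq_rat_strictAnti_tendsto (b i)
  set I := ∫⁻ y in univ.pi fun i => Icc (a i) (b i), ENNReal.ofReal |f y| with hI
  have hlim : Filter.Tendsto (fun k : ℕ => (ENNReal.ofReal (∏ i, ((v i k : ℝ) - u i k)))⁻¹ * I)
      Filter.atTop (nhds ((ENNReal.ofReal (∏ i, (b i - a i)))⁻¹ * I)) := by
    refine ENNReal.Tendsto.mul_const ?_ (Or.inl ?_)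
    · refine tendsto_inv_iff.2 (ENNReal.tendsto_ofReal ?_)
      exact tendsto_finsetProd _ fun i _ => (hv3 i).sub (hu3 i)
    · simp
  refine le_of_tendsto hlim (Filter.Eventually.of_forall fun k => ?_)
  let q : (Fin n → ℚ) × (Fin n → ℚ) := (fun i => u i k, fun i => v i k)
  refine le_trans ?_ (le_iSup _ q)
  have hsub : (univ.pi fun i => Icc (a i) (b i)) ⊆ box n q := by
    intro y hy i hi
    have := hy i hi
    exact ⟨(hu2 i k).le.trans this.1, this.2.trans (hv2 i k).le⟩
  rw [indicator_of_mem (hsub fun i _ => ⟨hax i, hxb i⟩)]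
  unfold boxAvg
  have hpos : ∀ i, 0 < (v i k : ℝ) - u i k := fun i => by
    have := hab i; have := hu2 i k; have := hv2 i k; linarith
  rw [ENNReal.ofReal_prod_of_nonneg fun i _ => (hpos i).le, ENNReal.prod_inv_distrib]
  · exact mul_le_mul_right (lintegral_mono_set hsub) _
  · intro i _ j _ _
    right; exact ENNReal.ofReal_ne_top

lemma upper_bound (n : ℕ) (p cp : ℝ) (hp : 1 < p) (hcp : 0 < cp)
    (hroot : (p - 1) * cp ^ p - p * cp ^ (p - 1) - 1 = 0) 
    (f : (Fin n → ℝ) → ℝ) (hf : Measurable f) :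
        (∫⁻ x, strongMax n f x ^ p) ^ (1 / p)
          ≤ ENNReal.ofReal (cp ^ n) * (∫⁻ x, ENNReal.ofReal |f x| ^ p) ^ (1 / p) := by
  have hp0 : 0 < p := by linarith
  have hF : Measurable fun y => ENNReal.ofReal |f y| :=
    ENNReal.measurable_ofReal.comp (measurable_norm.comp hf)
  have h1 : ∫⁻ x, strongMax n f x ^ p ≤
      ENNReal.ofReal (cp ^ p) ^ n * ∫⁻ x, ENNReal.ofReal |f x| ^ p :=
    (lintegral_mono fun x => ENNReal.rpow_le_rpow (strongMax_le_boxMax n f x) hp0.le).trans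
      (boxMax_bound p cp hp hcp hroot n _ hF)
  refine (ENNReal.rpow_le_rpow h1 (by positivity)).trans (le_of_eq ?_)
  rw [ENNReal.mul_rpow_of_nonneg _ _ (by positivity)]
  congr 1
  rw [← ENNReal.ofReal_pow (by positivity), ENNReal.ofReal_rpow_of_nonneg (by positivity)
    (by positivity)]
  congr 1
  rw [← Real.rpow_natCast, ← Real.rpow_mul hcp.le, ← Real.rpow_mul hcp.le, ← Real.rpow_natCast]
  congr 1
  field_simp

/-- Extremal profile. -/
noncomputable def prof (r : ℝ) (x : ℝ) : ℝ := if |x| ≤ 1 then r * |x| ^ (r - 1) else 0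

lemma measurable_prof (r : ℝ) : Measurable (prof r) := by
  unfold prof
  refine Measurable.ite (measurableSet_le measurable_norm measurable_const) ?_ measurable_const
  have : Measurable fun x : ℝ => |x| := measurable_norm
  exact (this.pow_const _).const_mul _

lemma prof_nonneg (r : ℝ) (hr : 0 < r) (x : ℝ) : 0 ≤ prof r x := by
  unfold prof; split_ifs <;> positivity

lemma prof_neg (r : ℝ) (x : ℝ) : prof r (-x) = prof r x := by
  unfold prof; simp

lemma lintegral_reflect (g : ℝ → ℝ≥0∞) (hg : ∀ x, g (-x) = g x) (a b : ℝ) :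
    ∫⁻ y in Ioo (-b) (-a), g y = ∫⁻ y in Ioo a b, g y := by
  have h := (Measure.measurePreserving_neg (volume : Measure ℝ)).setLIntegral_comp_preimage_emb
    (MeasurableEquiv.neg ℝ).measurableEmbedding g (Ioo a b)
  have h2 : (Neg.neg : ℝ → ℝ) ⁻¹' (Ioo a b) = Ioo (-b) (-a) := by
    ext x; simp only [mem_preimage, mem_Ioo]; constructor <;> rintro ⟨h1, h2⟩ <;> constructor <;> linarith
  rw [h2] at h
  rw [← h]
  exact lintegral_congr fun x => (hg x).symm

lemma prof_int (r : ℝ) (hr : 0 < r) (u : ℝ) (hu : 0 ≤ u) (hu1 : u ≤ 1) :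
    ∫⁻ y in Ioo 0 u, ENNReal.ofReal (prof r y) = ENNReal.ofReal (u ^ r) := by
  rw [← ENNReal.ofReal_rpow_of_nonneg hu hr.le, ← layer_fin r hr u hu]
  refine setLIntegral_congr_fun measurableSet_Ioo fun y hy => ?_
  have : |y| = y := abs_of_pos hy.1
  simp only [prof, this, if_pos (hy.2.le.trans hu1)]

lemma prof_int_neg (r : ℝ) (hr : 0 < r) (u : ℝ) (hu : 0 ≤ u) (hu1 : u ≤ 1) :
    ∫⁻ y in Ioo (-u) 0, ENNReal.ofReal (prof r y) = ENNReal.ofReal (u ^ r) := by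
  rw [← prof_int r hr u hu hu1]
  have := lintegral_reflect (fun y => ENNReal.ofReal (prof r y)) (fun x => by rw [prof_neg]) 0 u
  simpa using this

lemma prof_int_two (r : ℝ) (hr : 0 < r) (u v : ℝ) (hu : 0 ≤ u) (hu1 : u ≤ 1) (hv : 0 ≤ v)
    (hv1 : v ≤ 1) :
    ENNReal.ofReal (u ^ r + v ^ r) ≤ ∫⁻ y in Icc (-u) v, ENNReal.ofReal (prof r y) := by
  rw [ENNReal.ofReal_add (by positivity) (by positivity), ← prof_int_neg r hr u hu hu1,
    ← prof_int r hr v hv hv1, ← lintegral_union measurableSet_Ioo]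
  · refine lintegral_mono_set ?_
    rintro y (hy | hy)
    · exact ⟨hy.1.le, hy.2.le.trans hv⟩
    · exact ⟨by linarith [hy.1], hy.2.le⟩
  · rw [Set.disjoint_left]
    intro y h1 h2
    exact lt_asymm h1.2 h2.1

lemma prof_avg (r s : ℝ) (hr : 0 < r) (hr1 : r < 1) (hs : 0 < s) (hs1 : s ≤ 1) (x : ℝ) :
    ∃ a b : ℝ, a ≤ x ∧ x ≤ b ∧ a < b ∧
      ENNReal.ofReal ((1 + s ^ r) / (r * (1 + s)) * prof r x) ≤
        (ENNReal.ofReal (b - a))⁻¹ * ∫⁻ y in Icc a b, ENNReal.ofReal (prof r y) := by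
  have main : ∀ z : ℝ, 0 < z → z ≤ 1 → ∀ I : ℝ≥0∞, ENNReal.ofReal ((s * z) ^ r + z ^ r) ≤ I →
      ENNReal.ofReal ((1 + s ^ r) / (r * (1 + s)) * prof r z) ≤
        (ENNReal.ofReal (z + s * z))⁻¹ * I := by
    intro z hz hz1 I hI
    refine le_trans ?_ (mul_le_mul_right hI _)
    rw [← ENNReal.ofReal_inv_of_pos (by positivity), ← ENNReal.ofReal_mul (by positivity)]
    refine ENNReal.ofReal_le_ofReal (le_of_eq ?_)
    have habs : |z| = z := abs_of_pos hz
    rw [prof, habs, if_pos hz1, Real.mul_rpow hs.le hz.le, Real.rpow_sub_one hz.ne']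
    field_simp
    ring
  by_cases hx : 0 < |x| ∧ |x| ≤ 1
  · rcases lt_or_ge 0 x with h | h
    · have hx1 : x ≤ 1 := by rw [abs_of_pos h] at hx; exact hx.2
      have hsx : s * x ≤ 1 := by nlinarith
      have hsx0 : 0 < s * x := by positivity
      refine ⟨-(s*x), x, by linarith, le_rfl, by linarith, ?_⟩
      have := main x h hx1 _ (prof_int_two r hr (s*x) x hsx0.le hsx h.le hx1)
      rwa [sub_neg_eq_add]
    · have hx0 : x < 0 := lt_of_le_of_ne h (abs_pos.1 hx.1)
      have hx1 : -x ≤ 1 := by rw [abs_of_neg hx0] at hx; exact hx.2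
      have hsx : s * (-x) ≤ 1 := by nlinarith
      have hsx0 : 0 < s * (-x) := mul_pos hs (by linarith)
      refine ⟨x, s*(-x), le_rfl, by linarith, by linarith, ?_⟩
      have h1 := prof_int_two r hr (-x) (s*(-x)) (by linarith) hx1 hsx0.le hsx
      rw [add_comm, neg_neg] at h1
      have := main (-x) (by linarith) hx1 _ h1
      rw [prof_neg] at this
      have e : s * (-x) - x = -x + s * (-x) := by ring
      rwa [e]
  · refine ⟨x, x+1, le_rfl, by linarith, by linarith, ?_⟩
    have : prof r x = 0 := by
      unfold prof
      split_ifs with h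
      · have h0 : |x| = 0 := by
          by_contra h'
          exact hx ⟨lt_of_le_of_ne (abs_nonneg x) (Ne.symm h'), h⟩
        rw [h0, Real.zero_rpow (by linarith)]; simp
      · rfl
    rw [this]; simp

lemma lintegral_pi_prod (g : ℝ → ℝ≥0∞) (hg : Measurable g) (n : ℕ) :
    ∀ S : Fin n → Set ℝ, (∀ i, MeasurableSet (S i)) →
    ∫⁻ y in univ.pi S, ∏ i, g (y i) = ∏ i, ∫⁻ t in S i, g t := by
  induction n with
  | zero =>
    intro S hS
    have hv : volume (univ.pi S) = 1 := by
      rw [volume_pi_pi]; simp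
    simp [hv]
  | succ n ih =>
    intro S hS
    rw [fubini_cons_set n (fun y => ∏ i, g (y i))
      (Finset.measurable_fun_prod _ fun i _ => hg.comp (measurable_pi_apply i)) S hS]
    simp only [Fin.prod_univ_succ, Fin.cons_zero, Fin.cons_succ]
    have hm : Measurable fun y : Fin n → ℝ => ∏ i, g (y i) :=
      Finset.measurable_fun_prod _ fun i _ => hg.comp (measurable_pi_apply i)
    simp_rw [lintegral_const_mul _ hm, ih _ (fun i => hS i.succ)]
    rw [lintegral_mul_const _ hg]

lemma prof_pow (r p : ℝ) (hr : 0 < r) (hr' : 0 < (r - 1) * p + 1) (hp : 1 < p) :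
    ∫⁻ x, ENNReal.ofReal (prof r x) ^ p ≠ 0 ∧ ∫⁻ x, ENNReal.ofReal (prof r x) ^ p ≠ ∞ := by
  have hp0 : 0 < p := by linarith
  set r' := (r - 1) * p + 1 with hr'def
  set g : ℝ → ℝ≥0∞ := fun x => ENNReal.ofReal (prof r x) ^ p with hg
  have h01 : ∫⁻ x in Ioo (0:ℝ) 1, g x = ENNReal.ofReal (r ^ p / r') := by
    have h1 : ∀ x ∈ Ioo (0:ℝ) 1, g x = ENNReal.ofReal (r ^ p / r') *
        ENNReal.ofReal (r' * x ^ (r' - 1)) := by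
      intro x hx
      have habs : |x| = x := abs_of_pos hx.1
      have hx0 := hx.1
      simp only [hg, prof, habs, if_pos hx.2.le]
      rw [ENNReal.ofReal_rpow_of_nonneg (by positivity) hp0.le, ← ENNReal.ofReal_mul (by positivity),
        Real.mul_rpow hr.le (by positivity), ← Real.rpow_mul hx0.le]
      have : r' - 1 = (r - 1) * p := by rw [hr'def]; ring
      rw [this]
      congr 1
      field_simp
    rw [setLIntegral_congr_fun measurableSet_Ioo h1, lintegral_const_mul, layer_fin r' hr' 1 zero_le_one]
    · simp
    · fun_prop
  have hneg : ∫⁻ x in Ioo (-1:ℝ) 0, g x = ENNReal.ofReal (r ^ p / r') := by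
    rw [← h01]
    have := lintegral_reflect g (fun x => by simp only [hg, prof_neg]) 0 1
    simpa using this
  constructor
  · have h2 : 0 < ∫⁻ x in Ioo (0:ℝ) 1, g x := by
      rw [h01]; simp only [ENNReal.ofReal_pos]; positivity
    exact (h2.trans_le (setLIntegral_le_lintegral _ _)).ne'
  · have h3 : ∫⁻ x, g x ≤ (∫⁻ x in Ioo (-1:ℝ) 0, g x) + ∫⁻ x in Ioo (0:ℝ) 1, g x := by
      have e1 : ∫⁻ x in Ioo (-1:ℝ) 0, g x = ∫⁻ x in Icc (-1:ℝ) 0, g x := by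
        rw [restrict_Ioo_eq_restrict_Icc]
      have e2 : ∫⁻ x in Ioo (0:ℝ) 1, g x = ∫⁻ x in Icc (0:ℝ) 1, g x := by
        rw [restrict_Ioo_eq_restrict_Icc]
      rw [e1, e2]
      refine le_trans ?_ (lintegral_union_le _ _ _)
      rw [Icc_union_Icc_eq_Icc (by norm_num) (by norm_num), ← lintegral_indicator measurableSet_Icc]
      refine lintegral_mono fun x => ?_
      by_cases hx : x ∈ Icc (-1:ℝ) 1
      · rw [indicator_of_mem hx]
      · have : ¬ |x| ≤ 1 := by rw [abs_le]; exact hx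
        simp only [hg, prof, if_neg this]
        simp [hp0]
    rw [h01, hneg] at h3
    exact ne_top_of_le_ne_top (by simp) h3

lemma strongMax_prof (n : ℕ) (r s : ℝ) (hr : 0 < r) (hr1 : r < 1) (hs : 0 < s) (hs1 : s ≤ 1)
    (x : Fin n → ℝ) :
    ENNReal.ofReal (((1 + s ^ r) / (r * (1 + s))) ^ n) * ENNReal.ofReal |∏ i, prof r (x i)| ≤
      strongMax n (fun y => ∏ i, prof r (y i)) x := by
  choose a b hax hxb hab h using fun i => prof_avg r s hr hr1 hs hs1 (x i)
  have habs : ∀ y : Fin n → ℝ, ENNReal.ofReal |∏ i, prof r (y i)| =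
      ∏ i, ENNReal.ofReal (prof r (y i)) := by
    intro y
    rw [abs_of_nonneg (Finset.prod_nonneg fun i _ => prof_nonneg r hr _),
      ENNReal.ofReal_prod_of_nonneg fun i _ => prof_nonneg r hr _]
  unfold strongMax
  refine le_iSup_of_le a (le_iSup_of_le b (le_iSup_of_le hax (le_iSup_of_le hxb
    (le_iSup_of_le hab ?_))))
  simp_rw [habs]
  rw [lintegral_pi_prod (fun t => ENNReal.ofReal (prof r t))
    (ENNReal.measurable_ofReal.comp (measurable_prof r)) n _ (fun _ => measurableSet_Icc),
    ENNReal.ofReal_prod_of_nonneg fun i _ => (sub_pos.2 (hab i)).le, ENNReal.prod_inv_distrib,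
    ← Finset.prod_mul_distrib, ENNReal.ofReal_pow (by positivity)]
  · have : ENNReal.ofReal ((1 + s ^ r) / (r * (1 + s))) ^ n =
        ∏ _i : Fin n, ENNReal.ofReal ((1 + s ^ r) / (r * (1 + s))) := by simp
    rw [this, ← Finset.prod_mul_distrib]
    refine Finset.prod_le_prod' fun i _ => ?_
    rw [← ENNReal.ofReal_mul (by positivity)]
    exact h i
  · intro i _ j _ _
    right; exact ENNReal.ofReal_ne_top

lemma lower_step (n : ℕ) (p : ℝ) (hp : 1 < p) (r s : ℝ) (hr : 1 - 1 / p < r) (hr1 : r < 1)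
    (hs : 0 < s) (hs1 : s ≤ 1) (c : ℝ) (hc : 0 ≤ c)
    (H : ∀ f : (Fin n → ℝ) → ℝ, Measurable f →
          (∫⁻ x, ENNReal.ofReal |f x| ^ p) < ∞ →
          (∫⁻ x, strongMax n f x ^ p) ^ (1 / p)
            ≤ ENNReal.ofReal c * (∫⁻ x, ENNReal.ofReal |f x| ^ p) ^ (1 / p)) :
    ((1 + s ^ r) / (r * (1 + s))) ^ n ≤ c := by
  have hp0 : 0 < p := by linarith
  have hr0 : 0 < r := by
    have : 1 / p < 1 := by rw [div_lt_one hp0]; exact hp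
    linarith
  have hr' : 0 < (r - 1) * p + 1 := by
    have : (1 - 1/p - 1) * p + 1 = 0 := by field_simp; ring
    nlinarith
  obtain ⟨hne0, hneT⟩ := prof_pow r p hr0 hr' hp
  set f : (Fin n → ℝ) → ℝ := fun y => ∏ i, prof r (y i) with hf
  have hfm : Measurable f :=
    Finset.measurable_fun_prod _ fun i _ => (measurable_prof r).comp (measurable_pi_apply i)
  have hFm : Measurable fun y => ENNReal.ofReal |f y| :=
    ENNReal.measurable_ofReal.comp (measurable_norm.comp hfm)
  have hB : ∫⁻ x, ENNReal.ofReal |f x| ^ p = ∏ _i : Fin n, ∫⁻ x, ENNReal.ofReal (prof r x) ^ p := by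
    have := lintegral_pi_prod (fun t => ENNReal.ofReal (prof r t) ^ p)
      ((ENNReal.measurable_ofReal.comp (measurable_prof r)).pow_const p) n (fun _ => univ)
      (fun _ => MeasurableSet.univ)
    simp only [pi_univ, Measure.restrict_univ] at this
    rw [← this]
    refine lintegral_congr fun x => ?_
    rw [hf]
    simp only
    rw [abs_of_nonneg (Finset.prod_nonneg fun i _ => prof_nonneg r hr0 _),
      ENNReal.ofReal_prod_of_nonneg fun i _ => prof_nonneg r hr0 _,
      ENNReal.prod_rpow_of_nonneg hp0.le]
  set B := ∫⁻ x, ENNReal.ofReal |f x| ^ p with hBdef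
  have hB0 : B ≠ 0 := by rw [hB]; exact Finset.prod_ne_zero_iff.2 fun _ _ => hne0
  have hBT : B ≠ ∞ := by rw [hB]; exact ENNReal.prod_ne_top fun _ _ => hneT
  have h1 := H f hfm (lt_top_iff_ne_top.2 hBT)
  set K := ((1 + s ^ r) / (r * (1 + s))) ^ n with hK
  have hK0 : 0 ≤ K := by positivity
  have h2 : ENNReal.ofReal K * B ^ (1/p) ≤ (∫⁻ x, strongMax n f x ^ p) ^ (1 / p) := by
    have : ENNReal.ofReal K ^ p * B ≤ ∫⁻ x, strongMax n f x ^ p := by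
      rw [hBdef, ← lintegral_const_mul _ (hFm.pow_const p)]
      refine lintegral_mono fun x => ?_
      rw [← ENNReal.mul_rpow_of_nonneg _ _ hp0.le]
      exact ENNReal.rpow_le_rpow (strongMax_prof n r s hr0 hr1 hs hs1 x) hp0.le
    refine le_trans (le_of_eq ?_) (ENNReal.rpow_le_rpow this (by positivity))
    rw [ENNReal.mul_rpow_of_nonneg _ _ (by positivity), ← ENNReal.rpow_mul]
    have : p * (1/p) = 1 := by field_simp
    rw [this, ENNReal.rpow_one]
  have h3 := h2.trans h1
  rw [ENNReal.mul_le_mul_iff_left, ENNReal.ofReal_le_ofReal_iff hc] at h3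
  · exact h3
  · simp [hB0, hBT, hp0]
  · exact ENNReal.rpow_ne_top_of_nonneg (by positivity) hBT

lemma lower_bound (n : ℕ) (p cp : ℝ) (hp : 1 < p) (hcp : 0 < cp)
    (hroot : (p - 1) * cp ^ p - p * cp ^ (p - 1) - 1 = 0) (c : ℝ) (hc : 0 ≤ c)
    (H : ∀ f : (Fin n → ℝ) → ℝ, Measurable f →
          (∫⁻ x, ENNReal.ofReal |f x| ^ p) < ∞ →
          (∫⁻ x, strongMax n f x ^ p) ^ (1 / p)
            ≤ ENNReal.ofReal c * (∫⁻ x, ENNReal.ofReal |f x| ^ p) ^ (1 / p)) :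
    cp ^ n ≤ c := by
  have hp0 : 0 < p := by linarith
  have hp1 : 0 < p - 1 := by linarith
  have hX := Real.rpow_pos_of_pos hcp (p-1)
  have hsplit : cp ^ p = cp ^ (p-1) * cp := by
    rw [← Real.rpow_add_one hcp.ne']; congr 1; ring
  have hc1 : 1 ≤ cp := by
    rw [hsplit] at hroot
    by_contra h
    push Not at h
    nlinarith [mul_pos hX hcp, mul_pos hX hp1]
  set s := cp ^ (-p) with hs
  have hs0 : 0 < s := Real.rpow_pos_of_pos hcp _
  have hs1 : s ≤ 1 := Real.rpow_le_one_of_one_le_of_nonpos hc1 (by linarith)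
  set r0 := 1 - 1/p with hr0
  have h1p : 1 / p < 1 := by rw [div_lt_one hp0]; exact hp
  have hr0pos : 0 < r0 := by rw [hr0]; linarith
  have hk : (1 + s ^ r0) / (r0 * (1 + s)) = cp := by
    have e1 : s ^ r0 = (cp ^ (p-1))⁻¹ := by
      rw [hs, hr0, ← Real.rpow_mul hcp.le, ← Real.rpow_neg hcp.le]
      congr 1; field_simp
    have e2 : s = (cp ^ (p-1) * cp)⁻¹ := by rw [hs, Real.rpow_neg hcp.le, hsplit]
    have e3 : r0 = (p-1)/p := by rw [hr0]; field_simp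
    rw [e1, e2, e3]
    rw [hsplit] at hroot
    set X := cp ^ (p-1)
    rw [div_eq_iff (by positivity)]
    field_simp
    linarith
  have hcont : ContinuousAt (fun r : ℝ => ((1 + s ^ r) / (r * (1 + s))) ^ n) r0 := by
    have h1 : ContinuousAt (fun r : ℝ => s ^ r) r0 := Real.continuousAt_const_rpow hs0.ne'
    refine ContinuousAt.pow (ContinuousAt.div (continuousAt_const.add h1)
      (continuousAt_id.mul continuousAt_const) ?_) n
    exact (mul_pos hr0pos (by linarith : (0:ℝ) < 1 + s)).ne'
  have hlim : Filter.Tendsto (fun r : ℝ => ((1 + s ^ r) / (r * (1 + s))) ^ n)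
      (nhdsWithin r0 (Ioi r0)) (nhds (cp ^ n)) := by
    have := hcont.tendsto
    rw [hk] at this
    exact this.mono_left nhdsWithin_le_nhds
  refine le_of_tendsto hlim ?_
  have hr01 : r0 < 1 := by rw [hr0]; have : 0 < 1/p := by positivity
                           linarith
  filter_upwards [Ioo_mem_nhdsGT hr01] with r hr
  exact lower_step n p hp r s hr.1 hr.2 hs0 hs1 c hc H

/-- The operator norm of the strong maximal function on `L^p(ℝⁿ)` is `c_p^n`,
where `c_p` is the unique positive root of `(p-1)x^p - px^(p-1) - 1 = 0`. -/
theorem strongMax_operator_norm (n : ℕ) (p cp : ℝ) (hp : 1 < p) (hcp : 0 < cp)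
    (hroot : (p - 1) * cp ^ p - p * cp ^ (p - 1) - 1 = 0) :
    (∀ f : (Fin n → ℝ) → ℝ, Measurable f →
        (∫⁻ x, ENNReal.ofReal |f x| ^ p) < ∞ →
        (∫⁻ x, strongMax n f x ^ p) ^ (1 / p)
          ≤ ENNReal.ofReal (cp ^ n) * (∫⁻ x, ENNReal.ofReal |f x| ^ p) ^ (1 / p))
    ∧ ∀ c : ℝ, 0 ≤ c →
        (∀ f : (Fin n → ℝ) → ℝ, Measurable f →
          (∫⁻ x, ENNReal.ofReal |f x| ^ p) < ∞ →
          (∫⁻ x, strongMax n f x ^ p) ^ (1 / p)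
            ≤ ENNReal.ofReal c * (∫⁻ x, ENNReal.ofReal |f x| ^ p) ^ (1 / p)) →
        cp ^ n ≤ c := by
  exact ⟨fun f hf _ => upper_bound n p cp hp hcp hroot f hf,
    fun c hc H => lower_bound n p cp hp hcp hroot c hc H⟩
end
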